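/- For any evolutionary PDE X ∈ B and any differential operator P = Σ_{s≥0} P_s ∂_x^s ∈ D, there exists a unique differential operator Q ∈ D such that {F,G}_Q = X.{F,G}_P − {X.F, G}_P − {F, X.G}_P for all local functionals F, G ∈ Λ; this Q (the Lie derivative Lie_X P) is given explicitly by Q = Σ_{s≥0} X̂(P_s)·∂_x^s − Σ_{k≥0} ( (∂X/∂u_k)·∂_x^k·P + P·(−∂_x)^k·(∂X/∂u_k) ), where · is composition of differential operators. -/

import Mathlib

open scoped BigOperators ContDiff

set_option maxHeartbeats 1000000
set_option synthInstance.maxHeartbeats 1000000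

noncomputable section

attribute [local instance] Classical.propDecidable

/-! ### The coefficient ring `C^∞(u₀)` : smooth functions on an open set `s ⊆ ℝ` -/

def SF (s : Set ℝ) : Subalgebra ℝ (ℝ → ℝ) where
  carrier := {f | ContDiffOn ℝ ∞ f s}
  mul_mem' hf hg := hf.mul hg
  add_mem' hf hg := hf.add hg
  algebraMap_mem' c := contDiffOn_const

/-- derivative (within `s`) of a smooth function, extended by `0` outside `s`. -/
def dSF (s : Set ℝ) (hs : IsOpen s) (f : SF s) : SF s :=
  ⟨fun x => if x ∈ s then derivWithin (f : ℝ → ℝ) s x else 0, by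
    have h1 : ContDiffOn ℝ ∞ (derivWithin (f : ℝ → ℝ) s) s :=
      f.2.derivWithin hs.uniqueDiffOn (by exact_mod_cast le_refl _)
    exact h1.congr fun x hx => if_pos hx⟩

/-! ### The ambient ring of (generalized) differential polynomials.

A monomial exponent `(z, b, l) : Mon` stands for
`u₁^z * ∏ₖ u_{k+2}^(b k) * (log u₁)^l`, and an element of `Rl s` is a finite
`C^∞(u₀)`-linear combination of such monomials.  Ordinary differential polynomials,
almost differential polynomials, etc. are carved out by predicates below. -/

abbrev Mon : Type := ℤ × (ℕ →₀ ℕ) × ℕ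

abbrev Rl (s : Set ℝ) := AddMonoidAlgebra (SF s) Mon

variable (s : Set ℝ)

/-- embedding of a smooth function of `u₀` as a differential polynomial -/
def CF (c : SF s) : Rl s := AddMonoidAlgebra.single (0, 0, 0) c

/-- the function `u₀ ↦ u₀` -/
def idSF : SF s := ⟨fun x => x, contDiffOn_id⟩

/-- the jet variable `u_ℓ = ∂ₓ^ℓ u` as an element of `Rl s` -/
def uVar : ℕ → Rl s
  | 0 => AddMonoidAlgebra.single (0, 0, 0) (idSF s)
  | 1 => AddMonoidAlgebra.single (1, 0, 0) 1
  | (k+2) => AddMonoidAlgebra.single (0, Finsupp.single k 1, 0) 1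

/-- `log u₁` as an element of `Rl s` -/
def logUx : Rl s := AddMonoidAlgebra.single (0, 0, 1) 1

variable (hs : IsOpen s)

/-- the partial derivative `∂/∂u_i` on `Rl s` -/
def pd (i : ℕ) (p : Rl s) : Rl s :=
  match i with
  | 0 => Finsupp.sum p.coeff fun m c => AddMonoidAlgebra.single m (dSF s hs c)
  | 1 => Finsupp.sum p.coeff fun m c =>
      AddMonoidAlgebra.single (m.1 - 1, m.2.1, m.2.2) (m.1 • c)
      + AddMonoidAlgebra.single (m.1 - 1, m.2.1, m.2.2 - 1) (m.2.2 • c)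
  | (j+2) => Finsupp.sum p.coeff fun m c =>
      AddMonoidAlgebra.single (m.1, m.2.1 - Finsupp.single j 1, m.2.2) ((m.2.1 j) • c)

/-- the total `x`-derivative `∂ₓ = ∑ᵢ u_{i+1} ∂/∂uᵢ` -/
def dx (p : Rl s) : Rl s := ∑ᶠ i, uVar s (i+1) * pd s hs i p

/-- the variational derivative `δ/δu = ∑ᵢ (-∂ₓ)^i ∘ ∂/∂uᵢ` -/
def varDer (p : Rl s) : Rl s := ∑ᶠ i, (-1 : Rl s)^i * (dx s hs)^[i] (pd s hs i p)

/-- `X̂(p) = ∑ᵢ ∂ₓ^i(x) · ∂p/∂uᵢ`, the evolutionary vector field generated by `x` -/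
def XhatR (x p : Rl s) : Rl s := ∑ᶠ i, (dx s hs)^[i] x * pd s hs i p

/-! ### ε-series -/

/-- an `ε`-power series with coefficients in `Rl s`; `a n` is the coefficient of `ε^n`. -/
abbrev Ser := ℕ → Rl s

def mulSer (a b : Ser s) : Ser s := fun n => ∑ k ∈ Finset.range (n+1), a k * b (n-k)

def XhatSer (X f : Ser s) : Ser s :=
  fun n => ∑ k ∈ Finset.range (n+1), XhatR s hs (X k) (f (n-k))

/-- the Lie bracket `[X,Y] = X̂(Y) - Ŷ(X)` on vector fields -/
def brk (X Y : Ser s) : Ser s := fun n => XhatSer s hs X Y n - XhatSer s hs Y X n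

def varDerSer (f : Ser s) : Ser s := fun n => varDer s hs (f n)

def dxSer (f : Ser s) : Ser s := fun n => dx s hs (f n)

/-- multiplication by `ε` -/
def shiftEps (a : Ser s) : Ser s := fun n => match n with | 0 => 0 | m+1 => a m

/-! ### gradings and the various subspaces -/

/-- total degree of a monomial, where `deg u_ℓ = ℓ`, `deg (log u₁) = 0`. -/
def wtM (m : Mon) : ℤ := m.1 + (m.2.1.sum fun k e => ((k:ℤ)+2) * e)

/-- homogeneous of degree `d` -/
def IsHomog (d : ℤ) (p : Rl s) : Prop := ∀ m ∈ p.coeff.support, wtM m = d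

def NoLog (p : Rl s) : Prop := ∀ m ∈ p.coeff.support, m.2.2 = 0

/-- `p` is a genuine differential polynomial, i.e. `p ∈ R = C^∞(u₀)[u₁, u₂, …]` -/
def InR (p : Rl s) : Prop := NoLog s p ∧ ∀ m ∈ p.coeff.support, 0 ≤ m.1

/-- `p` is an almost differential polynomial, i.e.
`p ∈ R̃ = C^∞(u₀)[u₁, u₂/u₁², u₃/u₁³, …]` -/
def InRt (p : Rl s) : Prop := NoLog s p ∧ ∀ m ∈ p.coeff.support, 0 ≤ wtM m

/-- `p` depends only on `u, uₓ, …, u⁽ᴺ⁾` -/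
def UsesVarsLe (N : ℕ) (p : Rl s) : Prop :=
  ∀ m ∈ p.coeff.support, (m.1 ≠ 0 → 1 ≤ N) ∧ ∀ k, m.2.1 k ≠ 0 → k + 2 ≤ N

/-- membership in `𝒜 = {∑_{i≥0} εⁱ fᵢ | fᵢ ∈ R, deg fᵢ = i}` -/
def InA (a : Ser s) : Prop := ∀ i, InR s (a i) ∧ IsHomog s i (a i)

/-- membership in `ℬ = {∑_{i≥1} εⁱ fᵢ | fᵢ ∈ R, deg fᵢ = i}` -/
def InB (a : Ser s) : Prop := InA s a ∧ a 0 = 0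

def InAt (a : Ser s) : Prop := ∀ i, InRt s (a i) ∧ IsHomog s i (a i)

/-- membership in `ℬ̃` (almost differential polynomial vector fields) -/
def InBt (a : Ser s) : Prop := InAt s a ∧ a 0 = 0

/-! ### local functionals -/

/-- the subspace `∂ₓ(·) ⊕ ℝ` by which densities are quotiented; `Pr` singles out the
class of densities used (`InA` for `Λ`, `InAt` for `Λ̃`). -/
def LamSub (Pr : Ser s → Prop) : Submodule ℝ (Ser s) :=
  Submodule.span ℝ
    ({a | ∃ b : Ser s, Pr b ∧ a = fun n => dx s hs (b n)} ∪
     {a | ∃ c : ℝ, a = fun n => if n = 0 then algebraMap ℝ (Rl s) c else 0})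

instance serHasQuotient : HasQuotient (Ser s) (Submodule ℝ (Ser s)) :=
  Submodule.hasQuotient (R := ℝ) (M := Ser s)

/-- the space of local functionals `Λ = 𝒜/(∂ₓ𝒜 ⊕ ℝ)` (resp. `Λ̃`). -/
abbrev Lam (Pr : Ser s → Prop) := (Ser s) ⧸ LamSub s hs Pr

instance lamAddCommGroup (Pr : Ser s → Prop) : AddCommGroup (Lam s hs Pr) :=
  Submodule.Quotient.addCommGroup _

instance lamModule (Pr : Ser s → Prop) : Module ℝ (Lam s hs Pr) :=
  Submodule.Quotient.module _

/-- the local functional `∫ f dx` with density `f` -/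
def intdx (Pr : Ser s → Prop) (f : Ser s) : Lam s hs Pr := Submodule.Quotient.mk f

/-! ### differential operators -/

/-- a differential operator `∑_{n,j} εⁿ P n j ∂ₓ^j`. -/
abbrev Op := ℕ → ℕ → Rl s

/-- membership in `𝒟 = {∑_{k≥0} ε^k ∑_{s=0}^{k+1} P_{k,s} ∂ₓ^{k+1-s} | P_{k,s} ∈ R, deg P_{k,s} = s}` -/
def InD (P : Op s) : Prop :=
  ∀ n j, (n+1 < j → P n j = 0) ∧
    (j ≤ n+1 → InR s (P n j) ∧ IsHomog s ((n:ℤ)+1-j) (P n j))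

/-- same, with almost differential polynomial coefficients (`𝒟̃`). -/
def InDt (P : Op s) : Prop :=
  ∀ n j, (n+1 < j → P n j = 0) ∧
    (j ≤ n+1 → InRt s (P n j) ∧ IsHomog s ((n:ℤ)+1-j) (P n j))

/-- application of an operator to an `ε`-series -/
def appOp (P : Op s) (a : Ser s) : Ser s :=
  fun n => ∑ k ∈ Finset.range (n+1), ∑ᶠ j, P k j * (dx s hs)^[j] (a (n-k))

/-- composition (product) of differential operators -/
def compOp (P Q : Op s) : Op s :=
  fun n j => ∑ k ∈ Finset.range (n+1), ∑ᶠ i, ∑ᶠ l, ∑ r ∈ Finset.range (i+1),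
    if i - r + l = j then (i.choose r : Rl s) * P k i * (dx s hs)^[r] (Q (n-k) l) else 0

/-- the density `(δF/δu) · P(δG/δu)` of the Poisson bracket `{F,G}_P` -/
def pbDen (P : Op s) (f g : Ser s) : Ser s :=
  mulSer s (varDerSer s hs f) (appOp s hs P (varDerSer s hs g))

/-- `P ∈ 𝒟` is a Hamiltonian operator:  `{F,G}_P = ∫ (δF/δu) P (δG/δu) dx` is a
Lie bracket on `Λ` (skew-symmetric and satisfying the Jacobi identity). -/
def IsHamOp (P : Op s) : Prop :=
  InD s P ∧
  (∀ f g : Ser s, InA s f → InA s g →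
      intdx s hs (InA s) (pbDen s hs P f g) + intdx s hs (InA s) (pbDen s hs P g f) = 0) ∧
  (∀ f g h : Ser s, InA s f → InA s g → InA s h →
      intdx s hs (InA s) (pbDen s hs P (pbDen s hs P f g) h)
    + intdx s hs (InA s) (pbDen s hs P (pbDen s hs P g h) f)
    + intdx s hs (InA s) (pbDen s hs P (pbDen s hs P h f) g) = 0)

/-- the operator `∑ₖ (∂X/∂uₖ)·∂ₓ^k` -/
def opL (X : Ser s) : Op s := fun n k => pd s hs k (X n)

/-- the operator `∑ₖ (-∂ₓ)^k ∘ (∂X/∂uₖ ·)`, written in normal form -/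
def opR (X : Ser s) : Op s := fun n j =>
  ∑ᶠ k, if j ≤ k then
    (-1 : Rl s)^k * (k.choose (k-j) : Rl s) * (dx s hs)^[k-j] (pd s hs k (X n)) else 0

/-- the Lie derivative `Lie_X P` of an operator along an evolutionary vector field,
given by formula (2.7) of the paper:
`Lie_X P = ∑_s X̂(P_s)∂ₓ^s - ∑ₖ ((∂X/∂uₖ)·∂ₓ^k·P + P·(-∂ₓ)^k·(∂X/∂uₖ))`. -/
def LieOp (X : Ser s) (P : Op s) : Op s := fun n j =>
  (∑ k ∈ Finset.range (n+1), XhatR s hs (X k) (P (n-k) j))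
  - compOp s hs (opL s hs X) P n j - compOp s hs P (opR s hs X) n j

/-! ### Miura / quasi-Miura transformations `g_Y = e^{ad_Y}` -/

/-- action of `g_Y = e^{ad_Y}` on vector fields (`ad_Y X = [Y,X]`);
the sum may be truncated at order `m = n` since `Y` has no `ε⁰`-term. -/
def gV (Y X : Ser s) : Ser s :=
  fun n => ∑ m ∈ Finset.range (n+1), ((m.factorial : ℝ)⁻¹) • ((brk s hs Y)^[m] X n)

/-- action of `g_Y = e^{ad_Y}` on operators (`ad_Y P = Lie_Y P`) -/
def gOp (Y : Ser s) (P : Op s) : Op s :=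
  fun n j => ∑ m ∈ Finset.range (n+1), ((m.factorial : ℝ)⁻¹) • ((LieOp s hs Y)^[m] P n j)

/-- action of `g_Y = e^{ad_Y}` on local functionals, at the level of densities
(`ad_Y F = Y.F = ∫ Ŷ(f) dx`) -/
def gF (Y f : Ser s) : Ser s :=
  fun n => ∑ m ∈ Finset.range (n+1), ((m.factorial : ℝ)⁻¹) • ((XhatSer s hs Y)^[m] f n)

/-! ### some particular elements -/

/-- the hydrodynamic Hamiltonian operator `g(u)∂ₓ + ½ g'(u)uₓ` -/
def hydroOp (g : SF s) : Op s := fun n j =>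
  if n = 0 ∧ j = 1 then CF s g
  else if n = 0 ∧ j = 0 then (1/2 : ℝ) • (CF s (dSF s hs g) * uVar s 1) else 0

/-- the differential polynomial `f(u)·uₓ` -/
def fux (f : SF s) : Rl s := CF s f * uVar s 1

/-- the vector field `ε f(u) uₓ` -/
def bfield (f : SF s) : Ser s := fun n => if n = 1 then fux s f else 0

/-- the series `u` itself (at order `ε⁰`) -/
def uSer : Ser s := fun n => if n = 0 then uVar s 0 else 0

def onesSer : Ser s := fun n => if n = 0 then 1 else 0

def serPow (a : Ser s) : ℕ → Ser s
  | 0 => onesSer s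
  | (j+1) => mulSer s a (serPow a j)

def iterDSF : ℕ → SF s → SF s
  | 0, f => f
  | (j+1), f => dSF s hs (iterDSF j f)

/-- substitution of an `ε`-series `v = u + O(ε)` into a smooth function `f`,
via the Taylor expansion `f(v) = ∑ⱼ f⁽ʲ⁾(u)(v-u)ʲ/j!`. -/
def fSubst (f : SF s) (v : Ser s) : Ser s := fun n =>
  ∑ j ∈ Finset.range (n+1), ((j.factorial : ℝ)⁻¹) •
    (mulSer s (fun m => if m = 0 then CF s (iterDSF s hs j f) else 0)
      (serPow s (fun m => v m - uSer s m) j)) n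

/-- the multiplication operator by `q ∈ Rl s` -/
def multOp (q : Rl s) : Op s := fun n j => if n = 0 ∧ j = 0 then q else 0

/-- the operator `∂ₓ` -/
def dxOp : Op s := fun n j => if n = 0 ∧ j = 1 then 1 else 0


/-! ## Setting for this statement -/

abbrev S : Set ℝ := Set.univ

lemma hS : IsOpen S := isOpen_univ

local notation "RR" => Rl S
local notation "DD" => dx S hS
local notation "pp" => pd S hS
local notation "uu" => uVar S
local notation "VD" => varDer S hS
local notation "XH" => XhatR S hS


lemma dSF_apply (f : SF S) (x : ℝ) : (dSF S hS f : ℝ → ℝ) x = deriv (f : ℝ → ℝ) x := by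
  simp [dSF]

lemma SF_diff (f : SF S) (x : ℝ) : DifferentiableAt ℝ (f : ℝ → ℝ) x := by
  have h : ContDiffOn ℝ ∞ (f : ℝ → ℝ) Set.univ := f.2
  exact (contDiffOn_univ.1 h).differentiable (by simp) x

lemma dSF_add (f g : SF S) : dSF S hS (f + g) = dSF S hS f + dSF S hS g := by
  apply Subtype.ext; funext x
  show (dSF S hS (f + g) : ℝ → ℝ) x = (dSF S hS f : ℝ → ℝ) x + (dSF S hS g : ℝ → ℝ) x
  rw [dSF_apply, dSF_apply, dSF_apply]
  exact deriv_add (SF_diff f x) (SF_diff g x)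

lemma dSF_mul (f g : SF S) : dSF S hS (f * g) = dSF S hS f * g + f * dSF S hS g := by
  apply Subtype.ext; funext x
  show (dSF S hS (f * g) : ℝ → ℝ) x = (dSF S hS f : ℝ → ℝ) x * (g : ℝ → ℝ) x
    + (f : ℝ → ℝ) x * (dSF S hS g : ℝ → ℝ) x
  rw [dSF_apply, dSF_apply, dSF_apply]
  exact deriv_mul (SF_diff f x) (SF_diff g x)

lemma dSF_zero : dSF S hS 0 = 0 := by
  have := dSF_add 0 0
  simpa using this

lemma dSF_const (c : ℝ) : dSF S hS (algebraMap ℝ (SF S) c) = 0 := by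
  apply Subtype.ext; funext x
  show (dSF S hS (algebraMap ℝ (SF S) c) : ℝ → ℝ) x = 0
  rw [dSF_apply]
  show deriv (fun _ : ℝ => c) x = 0
  simp

lemma dSF_one : dSF S hS 1 = 0 := by
  have := dSF_const 1
  simpa using this

lemma dSF_id : dSF S hS (idSF S) = 1 := by
  apply Subtype.ext; funext x
  show (dSF S hS (idSF S) : ℝ → ℝ) x = 1
  rw [dSF_apply]
  show deriv (fun x : ℝ => x) x = 1
  simp

def dSFh : SF S →+ SF S := ⟨⟨dSF S hS, dSF_zero⟩, dSF_add⟩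

lemma dSF_nsmul (n : ℕ) (f : SF S) : dSF S hS (n • f) = n • dSF S hS f := map_nsmul dSFh n f
lemma dSF_zsmul (n : ℤ) (f : SF S) : dSF S hS (n • f) = n • dSF S hS f := map_zsmul dSFh n f

open AddMonoidAlgebra in
lemma pd0_single (m : Mon) (c : SF S) : pp 0 (single m c) = single m (dSF S hS c) := by
  simp only [pd, coeff_single]
  rw [Finsupp.sum_single_index]
  rw [dSF_zero, single_zero]

open AddMonoidAlgebra in
lemma pd1_single (m : Mon) (c : SF S) : pp 1 (single m c) =
    single (m.1 - 1, m.2.1, m.2.2) (m.1 • c)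
      + single (m.1 - 1, m.2.1, m.2.2 - 1) (m.2.2 • c) := by
  simp only [pd, coeff_single]
  rw [Finsupp.sum_single_index]
  simp

open AddMonoidAlgebra in
lemma pd2_single (j : ℕ) (m : Mon) (c : SF S) : pp (j+2) (single m c) =
    single (m.1, m.2.1 - Finsupp.single j 1, m.2.2) ((m.2.1 j) • c) := by
  simp only [pd, coeff_single]
  rw [Finsupp.sum_single_index]
  simp

lemma pd_add (i : ℕ) (p q : RR) : pp i (p + q) = pp i p + pp i q := by
  match i with
  | 0 =>
    simp only [pd, AddMonoidAlgebra.coeff_add]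
    apply Finsupp.sum_add_index'
    · intro m; simp [dSF_zero]
    · intro m c d; simp [dSF_add]
  | 1 =>
    simp only [pd, AddMonoidAlgebra.coeff_add]
    apply Finsupp.sum_add_index'
    · intro m; simp
    · intro m c d; simp only [smul_add, AddMonoidAlgebra.single_add]; abel
  | (j+2) =>
    simp only [pd, AddMonoidAlgebra.coeff_add]
    apply Finsupp.sum_add_index'
    · intro m; simp
    · intro m c d; simp only [smul_add, AddMonoidAlgebra.single_add]

lemma pd_zero (i : ℕ) : pp i (0 : RR) = 0 := by
  have := pd_add i 0 0
  simpa using this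

def pdh (i : ℕ) : RR →+ RR := ⟨⟨pp i, pd_zero i⟩, pd_add i⟩

lemma pd_sum {ι : Type*} (i : ℕ) (t : Finset ι) (f : ι → RR) :
    pp i (∑ k ∈ t, f k) = ∑ k ∈ t, pp i (f k) := map_sum (pdh i) f t

lemma pd_neg (i : ℕ) (p : RR) : pp i (-p) = -pp i p := map_neg (pdh i) p
lemma pd_sub (i : ℕ) (p q : RR) : pp i (p - q) = pp i p - pp i q := map_sub (pdh i) p q

open AddMonoidAlgebra in
lemma pd_mul_single (i : ℕ) (m m' : Mon) (c c' : SF S) :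
    pp i (single m c * single m' c') =
      pp i (single m c) * single m' c' + single m c * pp i (single m' c') := by
  obtain ⟨z, b, l⟩ := m
  obtain ⟨z', b', l'⟩ := m'
  rw [single_mul_single]
  match i with
  | 0 =>
    simp only [pd0_single, single_mul_single, dSF_mul, single_add]
  | 1 =>
    simp only [pd1_single, single_mul_single, add_mul, mul_add, Prod.mk_add_mk]
    have e1 : z - 1 + z' = z + z' - 1 := by ring
    have e2 : z + (z' - 1) = z + z' - 1 := by ring
    rw [e1, e2]
    have h3 : (single (z + z' - 1, b + b', l + l' - 1) ((l + l') • (c * c')) : RR)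
      = single (z + z' - 1, b + b', l - 1 + l') (l • c * c')
        + single (z + z' - 1, b + b', l + (l' - 1)) (c * l' • c') := by
      rcases l with _ | l
      · simp [mul_left_comm]
      rcases l' with _ | l'
      · simp [mul_assoc]
      have e4 : l + 1 - 1 + (l' + 1) = l + 1 + (l' + 1) - 1 := by omega
      have e5 : l + 1 + (l' + 1 - 1) = l + 1 + (l' + 1) - 1 := by omega
      rw [e4, e5, ← single_add]
      congr 1
      rw [add_smul, smul_mul_assoc, mul_smul_comm]
    rw [h3]
    have h4 : (z + z') • (c * c') = z • c * c' + c * z' • c' := by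
      rw [add_smul, smul_mul_assoc, mul_smul_comm]
    rw [h4, single_add]
    abel
  | (j+2) =>
    simp only [pd2_single, single_mul_single, Prod.mk_add_mk, Finsupp.add_apply]
    have e1 : (single (z + z', b - Finsupp.single j 1 + b', l + l') (b j • c * c') : RR)
      = single (z + z', b + b' - Finsupp.single j 1, l + l') (b j • c * c') := by
      by_cases h : b j = 0
      · simp [h]
      · congr 3
        ext k
        simp only [Finsupp.add_apply, Finsupp.tsub_apply, Finsupp.single_apply]
        split_ifs with hk
        · subst hk; omega
        · omega
    have e2 : (single (z + z', b + (b' - Finsupp.single j 1), l + l') (c * b' j • c') : RR)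
      = single (z + z', b + b' - Finsupp.single j 1, l + l') (c * b' j • c') := by
      by_cases h : b' j = 0
      · simp [h]
      · congr 3
        ext k
        simp only [Finsupp.add_apply, Finsupp.tsub_apply, Finsupp.single_apply]
        split_ifs with hk
        · subst hk; omega
        · omega
    rw [e1, e2, ← single_add]
    congr 1
    rw [add_smul, smul_mul_assoc, mul_smul_comm]

lemma pd_mul (i : ℕ) (p q : RR) : pp i (p * q) = pp i p * q + p * pp i q := by
  induction p using AddMonoidAlgebra.induction_linear with
  | zero => simp [pd_zero]
  | add f g hf hg => rw [add_mul, pd_add, hf, hg, pd_add]; ring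
  | single m c =>
    induction q using AddMonoidAlgebra.induction_linear with
    | zero => simp [pd_zero]
    | add f g hf hg => rw [mul_add, pd_add, hf, hg, pd_add]; ring
    | single m' c' => exact pd_mul_single i m m' c c'

open AddMonoidAlgebra in
lemma pd_comm_single (i j : ℕ) (m : Mon) (c : SF S) (hij : i < j) :
    pp i (pp j (single m c)) = pp j (pp i (single m c)) := by
  obtain ⟨z, b, l⟩ := m
  match i, j with
  | 0, 1 => simp only [pd0_single, pd1_single, pd_add, dSF_nsmul, dSF_zsmul]
  | 0, (j+2) => simp only [pd0_single, pd2_single, dSF_nsmul]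
  | 1, (j+2) =>
    simp only [pd1_single, pd2_single, pd_add]
    rw [smul_comm z (b j) c, smul_comm l (b j) c]
  | (i+2), (j+2) =>
    simp only [pd2_single]
    have hne : i ≠ j := by omega
    simp only [Finsupp.tsub_apply, Finsupp.single_apply, if_neg hne, if_neg hne.symm, tsub_zero]
    rw [smul_comm (b i) (b j) c, tsub_right_comm]
  | 1, 1 => omega
  | 1, 0 => omega
  | 0, 0 => omega
  | (i+2), 0 => omega
  | (i+2), 1 => omega

lemma pd_comm (i j : ℕ) (p : RR) : pp i (pp j p) = pp j (pp i p) := by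
  induction p using AddMonoidAlgebra.induction_linear with
  | zero => simp [pd_zero]
  | add f g hf hg => simp only [pd_add, hf, hg]
  | single m c =>
    rcases lt_trichotomy i j with h | h | h
    · exact pd_comm_single i j m c h
    · rw [h]
    · exact (pd_comm_single j i m c h).symm

lemma pd_uVar (i j : ℕ) : pp i (uu j) = if i = j then 1 else 0 := by
  have h1 : (1 : RR) = AddMonoidAlgebra.single (0, 0, 0) 1 := AddMonoidAlgebra.one_def
  match i, j with
  | 0, 0 => simp [uVar, pd0_single, dSF_id, h1]
  | 0, 1 => simp [uVar, pd0_single, dSF_one]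
  | 0, (j+2) => simp [uVar, pd0_single, dSF_one]
  | 1, 0 => simp [uVar, pd1_single]
  | 1, 1 => simp [uVar, pd1_single, h1]
  | 1, (j+2) => simp [uVar, pd1_single]
  | (i+2), 0 => simp [uVar, pd2_single]
  | (i+2), 1 => simp [uVar, pd2_single]
  | (i+2), (j+2) =>
    simp only [uVar, pd2_single, Finsupp.single_apply]
    by_cases h : j = i
    · subst h; simp [h1]
    · have h' : ¬ (i + 2 = j + 2) := by omega
      rw [if_neg h, if_neg h']; simp

lemma pd_fin (p : RR) : ∃ N, ∀ i, N ≤ i → pp i p = 0 := by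
  induction p using AddMonoidAlgebra.induction_linear with
  | zero => exact ⟨0, fun i _ => pd_zero i⟩
  | add f g hf hg =>
    obtain ⟨N, hN⟩ := hf
    obtain ⟨M, hM⟩ := hg
    refine ⟨max N M, fun i hi => ?_⟩
    rw [pd_add, hN i (le_trans (le_max_left _ _) hi), hM i (le_trans (le_max_right _ _) hi), add_zero]
  | single m c =>
    obtain ⟨N, hN⟩ := m.2.1.support.exists_nat_subset_range
    refine ⟨N + 2, fun i hi => ?_⟩
    obtain ⟨j, rfl⟩ : ∃ j, i = j + 2 := ⟨i - 2, by omega⟩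
    rw [pd2_single]
    have : m.2.1 j = 0 := by
      by_contra h
      have := hN (Finsupp.mem_support_iff.2 h)
      simp at this; omega
    simp [this]

lemma pd_real (i : ℕ) (c : ℝ) : pp i (algebraMap ℝ RR c) = 0 := by
  have h : algebraMap ℝ RR c = AddMonoidAlgebra.single (0, 0, 0) (algebraMap ℝ (SF S) c) := rfl
  rw [h]
  match i with
  | 0 => simp [pd0_single, dSF_const]
  | 1 => simp [pd1_single]
  | (j+2) => simp [pd2_single]

lemma pd_smul (i : ℕ) (c : ℝ) (p : RR) : pp i (c • p) = c • pp i p := by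
  rw [Algebra.smul_def, pd_mul, pd_real, zero_mul, zero_add, Algebra.smul_def]

lemma pd_one (i : ℕ) : pp i (1 : RR) = 0 := by
  have := pd_real i 1
  rwa [map_one] at this


lemma fsum_range {f : ℕ → RR} (N : ℕ) (h : ∀ i, N ≤ i → f i = 0) :
    ∑ᶠ i, f i = ∑ i ∈ Finset.range N, f i := by
  apply finsum_eq_sum_of_support_subset
  intro i hi
  simp only [Finset.coe_range, Set.mem_Iio]
  by_contra h'
  exact hi (h i (by omega))

lemma dx_eq (p : RR) (N : ℕ) (h : ∀ i, N ≤ i → pp i p = 0) :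
    DD p = ∑ i ∈ Finset.range N, uu (i+1) * pp i p :=
  fsum_range N fun i hi => by rw [h i hi, mul_zero]

lemma pd_fin2 (p q : RR) : ∃ N, (∀ i, N ≤ i → pp i p = 0) ∧ (∀ i, N ≤ i → pp i q = 0) := by
  obtain ⟨N, hN⟩ := pd_fin p
  obtain ⟨M, hM⟩ := pd_fin q
  exact ⟨max N M, fun i hi => hN i (le_trans (le_max_left _ _) hi),
    fun i hi => hM i (le_trans (le_max_right _ _) hi)⟩

lemma dx_add (p q : RR) : DD (p + q) = DD p + DD q := by
  obtain ⟨N, h1, h2⟩ := pd_fin2 p q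
  rw [dx_eq p N h1, dx_eq q N h2, dx_eq (p+q) N (fun i hi => by rw [pd_add, h1 i hi, h2 i hi, add_zero]),
    ← Finset.sum_add_distrib]
  exact Finset.sum_congr rfl fun i _ => by rw [pd_add, mul_add]

lemma dx_mul (p q : RR) : DD (p * q) = DD p * q + p * DD q := by
  obtain ⟨N, h1, h2⟩ := pd_fin2 p q
  rw [dx_eq p N h1, dx_eq q N h2, dx_eq (p*q) N (fun i hi => by rw [pd_mul, h1 i hi, h2 i hi]; simp),
    Finset.sum_mul, Finset.mul_sum, ← Finset.sum_add_distrib]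
  exact Finset.sum_congr rfl fun i _ => by rw [pd_mul]; ring

lemma dx_smul (c : ℝ) (p : RR) : DD (c • p) = c • DD p := by
  obtain ⟨N, h1⟩ := pd_fin p
  rw [dx_eq p N h1, dx_eq (c • p) N (fun i hi => by rw [pd_smul, h1 i hi, smul_zero]),
    Finset.smul_sum]
  exact Finset.sum_congr rfl fun i _ => by rw [pd_smul, mul_smul_comm]

lemma dx_zero : DD (0 : RR) = 0 := by
  have := dx_add 0 0
  simpa using this

def dxh : RR →+ RR := ⟨⟨DD, dx_zero⟩, dx_add⟩

lemma dx_sum {ι : Type*} (t : Finset ι) (f : ι → RR) :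
    DD (∑ k ∈ t, f k) = ∑ k ∈ t, DD (f k) := map_sum dxh f t
lemma dx_neg (p : RR) : DD (-p) = - DD p := map_neg dxh p
lemma dx_sub (p q : RR) : DD (p - q) = DD p - DD q := map_sub dxh p q

/-- iterates -/
lemma di_succ (k : ℕ) (p : RR) : (DD)^[k+1] p = DD ((DD)^[k] p) := Function.iterate_succ_apply' _ _ _
lemma di_succ' (k : ℕ) (p : RR) : (DD)^[k+1] p = (DD)^[k] (DD p) := Function.iterate_succ_apply _ _ _

lemma di_add (k : ℕ) (p q : RR) : (DD)^[k] (p + q) = (DD)^[k] p + (DD)^[k] q := by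
  induction k with
  | zero => rfl
  | succ k ih => rw [di_succ, ih, dx_add, di_succ, di_succ]

lemma di_zero (k : ℕ) : (DD)^[k] (0 : RR) = 0 := by
  have := di_add k 0 0
  simpa using this

def dih (k : ℕ) : RR →+ RR := ⟨⟨(DD)^[k], di_zero k⟩, di_add k⟩

lemma di_sum {ι : Type*} (k : ℕ) (t : Finset ι) (f : ι → RR) :
    (DD)^[k] (∑ i ∈ t, f i) = ∑ i ∈ t, (DD)^[k] (f i) := map_sum (dih k) f t
lemma di_neg (k : ℕ) (p : RR) : (DD)^[k] (-p) = - (DD)^[k] p := map_neg (dih k) p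
lemma di_sub (k : ℕ) (p q : RR) : (DD)^[k] (p - q) = (DD)^[k] p - (DD)^[k] q := map_sub (dih k) p q

lemma di_smul (k : ℕ) (c : ℝ) (p : RR) : (DD)^[k] (c • p) = c • (DD)^[k] p := by
  induction k with
  | zero => rfl
  | succ k ih => rw [di_succ, ih, dx_smul, di_succ]

lemma neg_one_mul_di (i k : ℕ) (p : RR) : (DD)^[k] ((-1)^i * p) = (-1)^i * (DD)^[k] p := by
  induction i with
  | zero => simp
  | succ i ih =>
    have e : ∀ y : RR, (-1)^(i+1) * y = -((-1)^i * y) := fun y => by rw [pow_succ]; ring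
    rw [e, e, di_neg, ih]

lemma di_leib (k : ℕ) (p q : RR) : (DD)^[k] (p * q) =
    ∑ r ∈ Finset.range (k+1), (k.choose r : RR) * ((DD)^[r] p * (DD)^[k-r] q) := by
  induction k with
  | zero => simp
  | succ k ih =>
    have key : ∀ m, ((DD)^[m+1] : RR → RR) = fun x => DD ((DD)^[m] x) := fun m => by
      funext x; exact di_succ m x
    rw [di_succ, ih, dx_sum]
    have h1 : ∀ r ∈ Finset.range (k+1), DD ((k.choose r : RR) * ((DD)^[r] p * (DD)^[k-r] q))
      = (k.choose r : RR) * ((DD)^[r+1] p * (DD)^[k-r] q)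
        + (k.choose r : RR) * ((DD)^[r] p * (DD)^[k+1-r] q) := by
      intro r hr
      have hr' : k + 1 - r = (k - r) + 1 := by have := Finset.mem_range.1 hr; omega
      rw [hr', di_succ, di_succ, ← nsmul_eq_mul, ← nsmul_eq_mul, ← nsmul_eq_mul, ← smul_add, ← dx_mul]
      exact map_nsmul dxh _ _
    rw [Finset.sum_congr rfl h1, Finset.sum_add_distrib, Finset.sum_range_succ' _ (k+1)]
    have h2 : ∀ r ∈ Finset.range (k+1), (((k+1).choose (r+1) : ℕ) : RR) * ((DD)^[r+1] p * (DD)^[k+1-(r+1)] q)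
      = (k.choose r : RR) * ((DD)^[r+1] p * (DD)^[k-r] q)
        + (k.choose (r+1) : RR) * ((DD)^[r+1] p * (DD)^[k+1-(r+1)] q) := by
      intro r _
      have : k + 1 - (r+1) = k - r := by omega
      rw [this, Nat.choose_succ_succ]; push_cast; ring
    rw [Finset.sum_congr rfl h2, Finset.sum_add_distrib, add_assoc]
    congr 1
    rw [Finset.sum_range_succ' _ k]
    rw [Finset.sum_range_succ (fun r => (k.choose (r+1) : RR) * ((DD)^[r+1] p * (DD)^[k+1-(r+1)] q)) k]
    simp

/-- commutation of partial derivatives with the total derivative -/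
lemma pd_dx_succ (i : ℕ) (p : RR) : pp (i+1) (DD p) = DD (pp (i+1) p) + pp i p := by
  obtain ⟨N0, h0⟩ := pd_fin p
  obtain ⟨N, hN⟩ : ∃ N, N0 ≤ N ∧ i < N := ⟨max N0 (i+1), le_max_left _ _, by omega⟩
  have h1 : ∀ j, N ≤ j → pp j p = 0 := fun j hj => h0 j (by omega)
  rw [dx_eq p N h1, dx_eq (pp (i+1) p) N (fun j hj => by rw [pd_comm, h1 j hj, pd_zero]), pd_sum]
  have : ∀ j ∈ Finset.range N, pp (i+1) (uu (j+1) * pp j p)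
      = (if j = i then pp i p else 0) + uu (j+1) * pp j (pp (i+1) p) := by
    intro j _
    rw [pd_mul, pd_uVar, pd_comm (i+1) j]
    by_cases h : j = i
    · subst h; simp
    · have h' : ¬ (i + 1 = j + 1) := by omega
      rw [if_neg h, if_neg h']; simp
  rw [Finset.sum_congr rfl this, Finset.sum_add_distrib, add_comm, Finset.sum_ite_eq']
  simp [hN.2]

lemma pd_dx_zero (p : RR) : pp 0 (DD p) = DD (pp 0 p) := by
  obtain ⟨N, h1⟩ := pd_fin p
  rw [dx_eq p N h1, dx_eq (pp 0 p) N (fun j hj => by rw [pd_comm, h1 j hj, pd_zero]), pd_sum]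
  refine Finset.sum_congr rfl fun j _ => ?_
  rw [pd_mul, pd_uVar, pd_comm 0 j]
  simp

lemma VD_eq (p : RR) (N : ℕ) (h : ∀ i, N ≤ i → pp i p = 0) :
    VD p = ∑ i ∈ Finset.range N, (-1)^i * (DD)^[i] (pp i p) :=
  fsum_range N fun i hi => by rw [h i hi, di_zero, mul_zero]

lemma VD_zero : VD (0 : RR) = 0 := by
  rw [VD_eq 0 0 (fun i _ => pd_zero i)]; simp

lemma VD_smul (c : ℝ) (p : RR) : VD (c • p) = c • VD p := by
  obtain ⟨N, h1⟩ := pd_fin p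
  rw [VD_eq p N h1, VD_eq (c • p) N (fun i hi => by rw [pd_smul, h1 i hi, smul_zero]),
    Finset.smul_sum]
  exact Finset.sum_congr rfl fun i _ => by rw [pd_smul, di_smul, mul_smul_comm]

lemma VD_add (p q : RR) : VD (p + q) = VD p + VD q := by
  obtain ⟨N, h1, h2⟩ := pd_fin2 p q
  rw [VD_eq p N h1, VD_eq q N h2, VD_eq (p+q) N (fun i hi => by rw [pd_add, h1 i hi, h2 i hi, add_zero]),
    ← Finset.sum_add_distrib]
  exact Finset.sum_congr rfl fun i _ => by rw [pd_add, di_add, mul_add]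

def VDh : RR →+ RR := ⟨⟨VD, VD_zero⟩, VD_add⟩

lemma VD_sum {ι : Type*} (t : Finset ι) (f : ι → RR) :
    VD (∑ k ∈ t, f k) = ∑ k ∈ t, VD (f k) := map_sum VDh f t

lemma pd_dx_fin (p : RR) (N : ℕ) (h : ∀ i, N ≤ i → pp i p = 0) (i : ℕ) (hi : N + 1 ≤ i) :
    pp i (DD p) = 0 := by
  obtain ⟨j, rfl⟩ : ∃ j, i = j + 1 := ⟨i - 1, by omega⟩
  rw [pd_dx_succ, h _ (by omega), h _ (by omega), dx_zero, add_zero]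

lemma VD_dx (p : RR) : VD (DD p) = 0 := by
  obtain ⟨N, h⟩ := pd_fin p
  rw [VD_eq (DD p) (N+1) (pd_dx_fin p N h), Finset.sum_range_succ']
  have h1 : ∀ i ∈ Finset.range N, (-1 : RR)^(i+1) * (DD)^[i+1] (pp (i+1) (DD p))
      = (-1 : RR)^(i+1) * (DD)^[i+2] (pp (i+1) p) - (-1 : RR)^i * (DD)^[i+1] (pp i p) := by
    intro i _
    rw [pd_dx_succ, di_add, ← di_succ', pow_succ]; ring
  rw [Finset.sum_congr rfl h1,
    Finset.sum_range_sub (fun i => (-1 : RR)^i * (DD)^[i+1] (pp i p)), h N le_rfl, pd_dx_zero]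
  simp [di_zero]

lemma XH_eq (x p : RR) (N : ℕ) (h : ∀ i, N ≤ i → pp i p = 0) :
    XH x p = ∑ i ∈ Finset.range N, (DD)^[i] x * pp i p :=
  fsum_range N fun i hi => by rw [h i hi, mul_zero]

lemma XH_zero (x : RR) : XH x 0 = 0 := by
  rw [XH_eq x 0 0 (fun i _ => pd_zero i)]; simp

lemma XH_add (x p q : RR) : XH x (p + q) = XH x p + XH x q := by
  obtain ⟨N, h1, h2⟩ := pd_fin2 p q
  rw [XH_eq x p N h1, XH_eq x q N h2, XH_eq x (p+q) N (fun i hi => by rw [pd_add, h1 i hi, h2 i hi, add_zero]),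
    ← Finset.sum_add_distrib]
  exact Finset.sum_congr rfl fun i _ => by rw [pd_add, mul_add]

def XHh (x : RR) : RR →+ RR := ⟨⟨XH x, XH_zero x⟩, XH_add x⟩

lemma XH_sum {ι : Type*} (x : RR) (t : Finset ι) (f : ι → RR) :
    XH x (∑ k ∈ t, f k) = ∑ k ∈ t, XH x (f k) := map_sum (XHh x) f t
lemma XH_neg (x p : RR) : XH x (-p) = - XH x p := map_neg (XHh x) p

lemma XH_mul (x p q : RR) : XH x (p * q) = XH x p * q + p * XH x q := by
  obtain ⟨N, h1, h2⟩ := pd_fin2 p q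
  rw [XH_eq x p N h1, XH_eq x q N h2, XH_eq x (p*q) N (fun i hi => by rw [pd_mul, h1 i hi, h2 i hi]; simp),
    Finset.sum_mul, Finset.mul_sum, ← Finset.sum_add_distrib]
  exact Finset.sum_congr rfl fun i _ => by rw [pd_mul]; ring

lemma XH_dx (x p : RR) : XH x (DD p) = DD (XH x p) := by
  obtain ⟨N, h⟩ := pd_fin p
  have hN1 : ∀ i, N + 1 ≤ i → pp i p = 0 := fun i hi => h i (by omega)
  rw [XH_eq x (DD p) (N+1) (pd_dx_fin p N h), XH_eq x p (N+1) hN1, dx_sum,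
    Finset.sum_range_succ']
  have h1 : ∀ i ∈ Finset.range N, (DD)^[i+1] x * pp (i+1) (DD p)
      = (DD)^[i+1] x * DD (pp (i+1) p) + (DD)^[i+1] x * pp i p := by
    intro i _
    rw [pd_dx_succ]; ring
  have h2 : ∀ i ∈ Finset.range (N+1), DD ((DD)^[i] x * pp i p)
      = (DD)^[i+1] x * pp i p + (DD)^[i] x * DD (pp i p) := by
    intro i _
    rw [dx_mul, di_succ]
  rw [Finset.sum_congr rfl h1, Finset.sum_congr rfl h2, Finset.sum_add_distrib, Finset.sum_add_distrib,
    pd_dx_zero, Finset.sum_range_succ' (fun i => (DD)^[i] x * DD (pp i p)), Finset.sum_range_succ, h N le_rfl]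
  simp only [mul_zero]
  ring

lemma XH_di (x p : RR) (k : ℕ) : XH x ((DD)^[k] p) = (DD)^[k] (XH x p) := by
  induction k with
  | zero => rfl
  | succ k ih => rw [di_succ, XH_dx, ih, di_succ]


lemma sum_sub' (t : Finset ℕ) (f g : ℕ → RR) :
    ∑ x ∈ t, (f x - g x) = ∑ x ∈ t, f x - ∑ x ∈ t, g x := Finset.sum_sub_distrib f g

lemma neg1_cases (i : ℕ) : (-1 : RR)^i = 1 ∨ (-1 : RR)^i = -1 := by
  induction i with
  | zero => left; rfl
  | succ i ih =>
    rcases ih with h | h <;> rw [pow_succ, h]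
    · right; ring
    · left; ring

lemma XH_sgn (x p : RR) (i : ℕ) : XH x ((-1)^i * p) = (-1)^i * XH x p := by
  rcases neg1_cases i with h | h <;> rw [h]
  · rw [one_mul, one_mul]
  · have e : ∀ y : RR, (-1) * y = - y := fun y => by ring
    rw [e, e, XH_neg]

def TT (x b : RR) : RR := ∑ᶠ i, (-1 : RR)^i * (DD)^[i] (pp i x * b)

lemma TT_eq (x b : RR) (N : ℕ) (h : ∀ i, N ≤ i → pp i x = 0) :
    TT x b = ∑ i ∈ Finset.range N, (-1 : RR)^i * (DD)^[i] (pp i x * b) :=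
  fsum_range N fun i hi => by rw [h i hi, zero_mul, di_zero, mul_zero]

lemma TT_add (x a b : RR) : TT x (a + b) = TT x a + TT x b := by
  obtain ⟨N, h⟩ := pd_fin x
  rw [TT_eq x _ N h, TT_eq x _ N h, TT_eq x _ N h, ← Finset.sum_add_distrib]
  exact Finset.sum_congr rfl fun i _ => by rw [mul_add, di_add, mul_add]

lemma TT_zero (x : RR) : TT x 0 = 0 := by
  have := TT_add x 0 0
  simpa using this

def TTh (x : RR) : RR →+ RR := ⟨⟨TT x, TT_zero x⟩, TT_add x⟩

lemma TT_sum {ι : Type*} (x : RR) (t : Finset ι) (f : ι → RR) :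
    TT x (∑ k ∈ t, f k) = ∑ k ∈ t, TT x (f k) := map_sum (TTh x) f t
lemma TT_neg (x p : RR) : TT x (-p) = - TT x p := map_neg (TTh x) p

lemma TT_dx (a b : RR) : TT (DD a) b = - TT a (DD b) := by
  obtain ⟨N, h⟩ := pd_fin a
  have hN1 : ∀ i, N + 1 ≤ i → pp i a = 0 := fun i hi => h i (by omega)
  rw [TT_eq (DD a) b (N+1) (pd_dx_fin a N h), TT_eq a _ N h, Finset.sum_range_succ']
  have h1 : ∀ i ∈ Finset.range N, (-1 : RR)^(i+1) * (DD)^[i+1] (pp (i+1) (DD a) * b)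
      = ((-1 : RR)^(i+1) * (DD)^[i+1] (DD (pp (i+1) a) * b) - (-1)^i * (DD)^[i] (DD (pp i a) * b))
        - (-1)^i * (DD)^[i] (pp i a * DD b) := by
    intro i _
    rw [pd_dx_succ, add_mul, di_add, di_succ' i (pp i a * b), dx_mul, di_add, pow_succ]
    ring
  rw [Finset.sum_congr rfl h1, sum_sub',
    Finset.sum_range_sub (fun i => (-1 : RR)^i * (DD)^[i] (DD (pp i a) * b)), h N le_rfl, pd_dx_zero]
  simp [dx_zero, di_zero]
  ring

lemma TT_di (a b : RR) (j : ℕ) : TT ((DD)^[j] a) b = TT a ((-1)^j * (DD)^[j] b) := by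
  induction j generalizing b with
  | zero => simp
  | succ j ih =>
    rw [di_succ, TT_dx, ih, ← TT_neg, di_succ', pow_succ]
    congr 1; ring

lemma VD_mul (a b : RR) : VD (a * b) = TT a b + TT b a := by
  obtain ⟨N, h1, h2⟩ := pd_fin2 a b
  rw [TT_eq a b N h1, TT_eq b a N h2, VD_eq (a*b) N (fun i hi => by rw [pd_mul, h1 i hi, h2 i hi]; simp),
    ← Finset.sum_add_distrib]
  exact Finset.sum_congr rfl fun i _ => by rw [pd_mul, di_add, mul_add, mul_comm (pp i b) a]

lemma VD_XH (x f : RR) : VD (XH x f) = XH x (VD f) + TT x (VD f) := by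
  obtain ⟨N, h⟩ := pd_fin f
  have hf : ∀ j i, N ≤ i → pp i (pp j f) = 0 := fun j i hi => by rw [pd_comm, h i hi, pd_zero]
  rw [XH_eq x f N h, VD_sum]
  have h1 : ∀ j ∈ Finset.range N, VD ((DD)^[j] x * pp j f)
      = TT x ((-1)^j * (DD)^[j] (pp j f)) +
        ∑ i ∈ Finset.range N, (-1 : RR)^i * (DD)^[i] ((DD)^[j] x * pp j (pp i f)) := by
    intro j _
    rw [VD_mul, TT_di, TT_eq (pp j f) _ N (hf j)]
    congr 1
    exact Finset.sum_congr rfl fun i _ => by rw [pd_comm i j, mul_comm (pp j (pp i f))]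
  rw [Finset.sum_congr rfl h1, Finset.sum_add_distrib, ← TT_sum, ← VD_eq f N h, add_comm]
  congr 1
  rw [Finset.sum_comm, VD_eq f N h, XH_sum]
  refine Finset.sum_congr rfl fun i _ => ?_
  rw [← Finset.mul_sum, ← di_sum, ← XH_eq x (pp i f) N (hf i)]
  rw [XH_sgn, XH_di]

def ap (p : ℕ → RR) (a : RR) : RR := ∑ᶠ j, p j * (DD)^[j] a

lemma ap_eq (p : ℕ → RR) (a : RR) (N : ℕ) (h : ∀ i, N ≤ i → p i = 0) :
    ap p a = ∑ i ∈ Finset.range N, p i * (DD)^[i] a :=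
  fsum_range N fun i hi => by rw [h i hi, zero_mul]

lemma ap_opL (x b : RR) : ap (fun k => pp k x) b = XH b x :=
  finsum_congr fun k => mul_comm _ _

lemma ap_opR (x a : RR) (p : ℕ → RR)
    (hp : ∀ j, p j = ∑ᶠ k, if j ≤ k then
      (-1 : RR)^k * (k.choose (k-j) : RR) * (DD)^[k-j] (pp k x) else 0) : ap p a = TT x a := by
  obtain ⟨N, h⟩ := pd_fin x
  have hp' : ∀ j, p j = ∑ k ∈ Finset.range N, if j ≤ k then
      (-1 : RR)^k * (k.choose (k-j) : RR) * (DD)^[k-j] (pp k x) else 0 := by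
    intro j
    rw [hp j]
    refine fsum_range N fun k hk => ?_
    rw [h k hk, di_zero, mul_zero, ite_self]
  have hz : ∀ j, N ≤ j → p j = 0 := by
    intro j hj
    rw [hp']
    refine Finset.sum_eq_zero fun k hk => ?_
    rw [if_neg]; have := Finset.mem_range.1 hk; omega
  rw [ap_eq p a N hz, TT_eq x a N h]
  simp only [hp', Finset.sum_mul]
  rw [Finset.sum_comm]
  refine Finset.sum_congr rfl fun k hk => ?_
  have hkN := Finset.mem_range.1 hk
  rw [di_leib, ← Finset.sum_range_reflect (fun r => (k.choose r : RR) * ((DD)^[r] (pp k x) * (DD)^[k-r] a)), Finset.mul_sum]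
  have hsub : Finset.range (k+1) ⊆ Finset.range N := by
    intro i; simp only [Finset.mem_range]; omega
  rw [← Finset.sum_subset hsub]
  · refine Finset.sum_congr rfl fun j hj => ?_
    have hjk := Finset.mem_range.1 hj
    rw [if_pos (by omega)]
    have e1 : k + 1 - 1 - j = k - j := by omega
    have e2 : k - (k - j) = j := by omega
    rw [e1, e2]; ring
  · intro j _ hj
    rw [if_neg, zero_mul]
    intro h'; exact hj (Finset.mem_range.2 (by omega))

def cmpR (p q : ℕ → RR) (j : ℕ) : RR := ∑ᶠ i, ∑ᶠ l, ∑ r ∈ Finset.range (i+1),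
    if i - r + l = j then (i.choose r : RR) * p i * (DD)^[r] (q l) else 0

lemma cmpR_eq (p q : ℕ → RR) (N : ℕ) (hp : ∀ i, N ≤ i → p i = 0) (hq : ∀ i, N ≤ i → q i = 0) (j : ℕ) :
    cmpR p q j = ∑ i ∈ Finset.range N, ∑ l ∈ Finset.range N, ∑ r ∈ Finset.range (i+1),
    if i - r + l = j then (i.choose r : RR) * p i * (DD)^[r] (q l) else 0 := by
  have h1 : ∀ i, ∑ᶠ l, ∑ r ∈ Finset.range (i+1),
      (if i - r + l = j then (i.choose r : RR) * p i * (DD)^[r] (q l) else 0)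
      = ∑ l ∈ Finset.range N, ∑ r ∈ Finset.range (i+1),
      (if i - r + l = j then (i.choose r : RR) * p i * (DD)^[r] (q l) else 0) := by
    intro i
    refine fsum_range N fun l hl => Finset.sum_eq_zero fun r _ => ?_
    rw [hq l hl, di_zero, mul_zero, ite_self]
  unfold cmpR
  rw [finsum_congr h1]
  refine fsum_range N fun i hi => Finset.sum_eq_zero fun l _ => Finset.sum_eq_zero fun r _ => ?_
  rw [hp i hi, mul_zero, zero_mul, ite_self]

lemma cmpR_zero (p q : ℕ → RR) (N : ℕ) (hp : ∀ i, N ≤ i → p i = 0) (hq : ∀ i, N ≤ i → q i = 0) (j : ℕ)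
    (hj : 2 * N ≤ j) : cmpR p q j = 0 := by
  rw [cmpR_eq p q N hp hq]
  refine Finset.sum_eq_zero fun i hi => Finset.sum_eq_zero fun l hl => Finset.sum_eq_zero fun r _ => ?_
  have := Finset.mem_range.1 hi
  have := Finset.mem_range.1 hl
  rw [if_neg (by omega)]

lemma ap_cmpR (p q : ℕ → RR) (a : RR) (N : ℕ) (hp : ∀ i, N ≤ i → p i = 0) (hq : ∀ i, N ≤ i → q i = 0) :
    ap (cmpR p q) a = ap p (ap q a) := by
  rw [ap_eq (cmpR p q) a (2*N) (cmpR_zero p q N hp hq), ap_eq p _ N hp, ap_eq q a N hq]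
  simp only [cmpR_eq p q N hp hq, Finset.sum_mul]
  rw [Finset.sum_comm]
  refine Finset.sum_congr rfl fun i hi => ?_
  rw [Finset.sum_comm, di_sum, Finset.mul_sum]
  refine Finset.sum_congr rfl fun l hl => ?_
  rw [Finset.sum_comm, di_leib, Finset.mul_sum]
  refine Finset.sum_congr rfl fun r hr => ?_
  have := Finset.mem_range.1 hi
  have := Finset.mem_range.1 hl
  have hm : i - r + l ∈ Finset.range (2*N) := Finset.mem_range.2 (by omega)
  rw [Finset.sum_eq_single_of_mem (i - r + l) hm]
  · rw [if_pos rfl, Function.iterate_add_apply]; ring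
  · intro j _ hj
    rw [if_neg (fun h => hj h.symm), zero_mul]

lemma ap_add_right (p : ℕ → RR) (N : ℕ) (h : ∀ i, N ≤ i → p i = 0) (a b : RR) :
    ap p (a + b) = ap p a + ap p b := by
  rw [ap_eq p _ N h, ap_eq p _ N h, ap_eq p _ N h, ← Finset.sum_add_distrib]
  exact Finset.sum_congr rfl fun i _ => by rw [di_add, mul_add]

lemma ap_zero_right (p : ℕ → RR) : ap p 0 = 0 := by
  unfold ap; simp [di_zero]

lemma ap_sum_right {ι : Type*} (p : ℕ → RR) (N : ℕ) (h : ∀ i, N ≤ i → p i = 0) (t : Finset ι) (f : ι → RR) :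
    ap p (∑ k ∈ t, f k) = ∑ k ∈ t, ap p (f k) :=
  map_sum (⟨⟨ap p, ap_zero_right p⟩, ap_add_right p N h⟩ : RR →+ RR) f t

lemma ap_sum_left {ι : Type*} (t : Finset ι) (p : ι → ℕ → RR) (N : ℕ)
    (h : ∀ k ∈ t, ∀ i, N ≤ i → p k i = 0) (a : RR) :
    ap (fun j => ∑ k ∈ t, p k j) a = ∑ k ∈ t, ap (p k) a := by
  rw [ap_eq _ _ N (fun i hi => Finset.sum_eq_zero fun k hk => h k hk i hi)]
  rw [Finset.sum_congr rfl fun k hk => ap_eq (p k) a N (h k hk), Finset.sum_comm]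
  exact Finset.sum_congr rfl fun i _ => by rw [Finset.sum_mul]

lemma XH_ap (x : RR) (p : ℕ → RR) (N : ℕ) (h : ∀ i, N ≤ i → p i = 0) (a : RR) :
    XH x (ap p a) = ap (fun j => XH x (p j)) a + ap p (XH x a) := by
  rw [ap_eq p _ N h, ap_eq p _ N h, ap_eq _ _ N (fun i hi => by rw [h i hi, XH_zero]), XH_sum,
    ← Finset.sum_add_distrib]
  exact Finset.sum_congr rfl fun i _ => by rw [XH_mul, XH_di]


def HH (d : ℤ) (p : RR) : Prop := ∀ m ∈ p.coeff.support, m.2.2 = 0 ∧ 0 ≤ m.1 ∧ wtM m = d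

lemma HH_iff (d : ℤ) (p : RR) : HH d p ↔ InR S p ∧ IsHomog S d p :=
  ⟨fun h => ⟨⟨fun m hm => (h m hm).1, fun m hm => (h m hm).2.1⟩, fun m hm => (h m hm).2.2⟩,
   fun h m hm => ⟨h.1.1 m hm, h.1.2 m hm, h.2 m hm⟩⟩

lemma HH_zero (d : ℤ) : HH d 0 := fun m hm => by simp at hm

lemma HH_add {d : ℤ} {p q : RR} (hp : HH d p) (hq : HH d q) : HH d (p + q) := by
  intro m hm
  rw [AddMonoidAlgebra.coeff_add] at hm
  rcases Finset.mem_union.1 (Finsupp.support_add hm) with h | h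
  · exact hp m h
  · exact hq m h

lemma HH_sum {ι : Type*} {d : ℤ} (t : Finset ι) (f : ι → RR) (h : ∀ k ∈ t, HH d (f k)) :
    HH d (∑ k ∈ t, f k) := by
  classical
  induction t using Finset.induction_on with
  | empty => simpa using HH_zero d
  | insert a t ha ih =>
    rw [Finset.sum_insert ha]
    exact HH_add (h a (Finset.mem_insert_self _ _)) (ih fun k hk => h k (Finset.mem_insert_of_mem hk))

lemma HH_single {d : ℤ} {m : Mon} (c : SF S) (h : m.2.2 = 0 ∧ 0 ≤ m.1 ∧ wtM m = d) :
    HH d (AddMonoidAlgebra.single m c) := by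
  intro m' hm'
  rw [AddMonoidAlgebra.coeff_single] at hm'
  have := Finsupp.support_single_subset hm'
  rw [Finset.mem_singleton] at this
  rw [this]; exact h

lemma HH_ind {d : ℤ} {Pr : RR → Prop} (h0 : Pr 0) (ha : ∀ p q, Pr p → Pr q → Pr (p + q))
    (hs : ∀ (m : Mon) (c : SF S), m.2.2 = 0 ∧ 0 ≤ m.1 ∧ wtM m = d → Pr (AddMonoidAlgebra.single m c))
    {p : RR} (hp : HH d p) : Pr p := by
  rw [← AddMonoidAlgebra.sum_coeff_single p, Finsupp.sum]
  have : ∀ t : Finset Mon, (∀ m ∈ t, m.2.2 = 0 ∧ 0 ≤ m.1 ∧ wtM m = d) →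
      Pr (∑ m ∈ t, AddMonoidAlgebra.single m (p.coeff m)) := by
    intro t
    induction t using Finset.induction_on with
    | empty => intro _; simpa using h0
    | insert a t hat ih =>
      intro h
      rw [Finset.sum_insert hat]
      exact ha _ _ (hs _ _ (h a (Finset.mem_insert_self _ _)))
        (ih fun k hk => h k (Finset.mem_insert_of_mem hk))
  exact this _ hp

lemma wtM_add (m m' : Mon) : wtM (m + m') = wtM m + wtM m' := by
  unfold wtM
  rw [Prod.fst_add, Prod.snd_add, Prod.fst_add, Finsupp.sum_add_index']
  · ring
  · intro k; simp
  · intro k a b; push_cast; ring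

lemma HH_mul {d e : ℤ} {p q : RR} (hp : HH d p) (hq : HH e q) : HH (d + e) (p * q) := by
  refine HH_ind (Pr := fun p => HH (d + e) (p * q)) ?_ ?_ ?_ hp
  · simpa using HH_zero _
  · intro p q h1 h2; rw [add_mul]; exact HH_add h1 h2
  intro m c hm
  refine HH_ind (Pr := fun q => HH (d + e) (AddMonoidAlgebra.single m c * q)) ?_ ?_ ?_ hq
  · simpa using HH_zero _
  · intro p q h1 h2; rw [mul_add]; exact HH_add h1 h2
  intro m' c' hm'
  rw [AddMonoidAlgebra.single_mul_single]
  refine HH_single _ ⟨?_, ?_, ?_⟩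
  · simp [hm.1, hm'.1]
  · have := hm.2.1; have := hm'.2.1; rw [Prod.fst_add]; omega
  · rw [wtM_add, hm.2.2, hm'.2.2]

lemma HH_neg {d : ℤ} {p : RR} (hp : HH d p) : HH d (-p) := by
  intro m hm
  have e : (-p).coeff.support = p.coeff.support := by
    rw [show (-p).coeff = - p.coeff from rfl, Finsupp.support_neg]
  rw [e] at hm
  exact hp m hm

lemma HH_sub {d : ℤ} {p q : RR} (hp : HH d p) (hq : HH d q) : HH d (p - q) := by
  rw [sub_eq_add_neg]; exact HH_add hp (HH_neg hq)

lemma HH_sgn {d : ℤ} {p : RR} (hp : HH d p) (i : ℕ) : HH d ((-1)^i * p) := by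
  rcases neg1_cases i with h | h <;> rw [h]
  · rwa [one_mul]
  · have e : (-1) * p = -p := by ring
    rw [e]; exact HH_neg hp

lemma HH_nat {d : ℤ} {p : RR} (hp : HH d p) (n : ℕ) : HH d ((n : RR) * p) := by
  induction n with
  | zero => simpa using HH_zero d
  | succ n ih => rw [Nat.cast_succ, add_mul, one_mul]; exact HH_add ih hp

lemma HH_uVar (k : ℕ) : HH k (uu k) := by
  match k with
  | 0 => exact HH_single _ ⟨rfl, le_rfl, by simp [wtM]⟩
  | 1 => exact HH_single _ ⟨rfl, by norm_num, by simp [wtM]⟩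
  | (k+2) => exact HH_single _ ⟨rfl, le_rfl, by simp [wtM]⟩

lemma HH_pd {d : ℤ} {p : RR} (hp : HH d p) (i : ℕ) : HH (d - i) (pp i p) := by
  refine HH_ind (Pr := fun p => HH (d - i) (pp i p)) ?_ ?_ ?_ hp
  · rw [pd_zero]; exact HH_zero _
  · intro p q h1 h2; rw [pd_add]; exact HH_add h1 h2
  rintro ⟨z, b, l⟩ c ⟨h1, h2, h3⟩
  simp only at h1 h2
  subst h1
  match i with
  | 0 => rw [pd0_single]; exact HH_single _ ⟨rfl, h2, by simpa using h3⟩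
  | 1 =>
    rw [pd1_single]
    simp only [zero_smul, AddMonoidAlgebra.single_zero, add_zero]
    rcases eq_or_lt_of_le h2 with h | h
    · subst h; simpa using HH_zero _
    · refine HH_single _ ⟨rfl, by simp only; omega, ?_⟩
      simp only [wtM] at h3 ⊢
      push_cast; linarith
  | (j+2) =>
    rw [pd2_single]
    simp only
    by_cases hb : b j = 0
    · rw [hb, zero_smul, AddMonoidAlgebra.single_zero]; exact HH_zero _
    · refine HH_single _ ⟨rfl, h2, ?_⟩
      have e : b = (b - Finsupp.single j 1) + Finsupp.single j 1 := by
        ext k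
        simp only [Finsupp.add_apply, Finsupp.tsub_apply, Finsupp.single_apply]
        split_ifs with hk
        · subst hk; omega
        · omega
      have e2 : ((z, b, 0) : Mon) = (z, b - Finsupp.single j 1, 0) + (0, Finsupp.single j 1, 0) := by
        simp only [Prod.mk_add_mk, add_zero]; rw [← e]
      rw [e2, wtM_add] at h3
      have e3 : wtM (0, Finsupp.single j 1, 0) = (j:ℤ) + 2 := by simp [wtM]
      rw [e3] at h3
      push_cast; linarith

lemma HH_neg_zero {d : ℤ} {p : RR} (hp : HH d p) (hd : d < 0) : p = 0 := by
  rw [← AddMonoidAlgebra.coeff_eq_zero, ← Finsupp.support_eq_empty, Finset.eq_empty_iff_forall_notMem]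
  intro m hm
  obtain ⟨_, h2, h3⟩ := hp m hm
  have : 0 ≤ m.2.1.sum fun k e => ((k:ℤ)+2) * e := Finset.sum_nonneg fun k _ => by positivity
  unfold wtM at h3; omega

lemma HH_pd_zero {d : ℤ} {p : RR} (hp : HH d p) (i : ℕ) (hi : d < i) : pp i p = 0 :=
  HH_neg_zero (HH_pd hp i) (by omega)

lemma HH_congr {d e : ℤ} {p : RR} (hp : HH d p) (h : d = e) : HH e p := h ▸ hp

lemma HH_dx {d : ℤ} {p : RR} (hp : HH d p) : HH (d + 1) (DD p) := by
  obtain ⟨N, h⟩ := pd_fin p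
  rw [dx_eq p N h]
  exact HH_sum _ _ fun i _ => HH_congr (HH_mul (HH_uVar (i+1)) (HH_pd hp i)) (by push_cast; ring)

lemma HH_di {d : ℤ} {p : RR} (hp : HH d p) (k : ℕ) : HH (d + k) ((DD)^[k] p) := by
  induction k with
  | zero => simpa using hp
  | succ k ih => rw [di_succ]; exact HH_congr (HH_dx ih) (by push_cast; ring)

lemma HH_VD {d : ℤ} {p : RR} (hp : HH d p) : HH d (VD p) := by
  obtain ⟨N, h⟩ := pd_fin p
  rw [VD_eq p N h]
  exact HH_sum _ _ fun i _ => HH_congr (HH_sgn (HH_di (HH_pd hp i) i) i) (by ring)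

lemma HH_XH {d e : ℤ} {x p : RR} (hx : HH e x) (hp : HH d p) : HH (e + d) (XH x p) := by
  obtain ⟨N, h⟩ := pd_fin p
  rw [XH_eq x p N h]
  exact HH_sum _ _ fun i _ => HH_congr (HH_mul (HH_di hx i) (HH_pd hp i)) (by ring)

lemma HH_ap {d e : ℤ} {p : ℕ → RR} {a : RR} (hp : ∀ j : ℕ, HH (e - j) (p j)) (ha : HH d a) :
    HH (e + d) (ap p a) := by
  have h : ∀ i, (e.toNat + 1) ≤ i → p i = 0 := fun i hi => HH_neg_zero (hp i) (by omega)
  rw [ap_eq p a _ h]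
  exact HH_sum _ _ fun i _ => HH_congr (HH_mul (hp i) (HH_di ha i)) (by ring)

/-- Euler's identity -/
lemma euler {d : ℤ} {p : RR} (hp : HH d p) (N : ℕ) (hN : ∀ i, N ≤ i → pp i p = 0) :
    ∑ i ∈ Finset.range N, (i : RR) * (uu i * pp i p) = d • p := by
  have e1 : ∑ i ∈ Finset.range N, (i : RR) * (uu i * pp i p) = ∑ᶠ i : ℕ, (i : RR) * (uu i * pp i p) :=
    (fsum_range N fun i hi => by rw [hN i hi, mul_zero, mul_zero]).symm
  rw [e1]
  have hf : ∀ q : RR, (Function.support fun i : ℕ => (i : RR) * (uu i * pp i q)).Finite := by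
    intro q
    obtain ⟨M, hM⟩ := pd_fin q
    refine (Finset.range M).finite_toSet.subset fun i hi => ?_
    simp only [Finset.coe_range, Set.mem_Iio]
    by_contra h
    exact hi (by simp only; rw [hM i (by omega), mul_zero, mul_zero])
  refine HH_ind (Pr := fun p => ∑ᶠ i : ℕ, (i : RR) * (uu i * pp i p) = d • p) ?_ ?_ ?_ hp
  · simp [pd_zero]
  · intro p q h1 h2
    rw [smul_add, ← h1, ← h2, ← finsum_add_distrib (hf p) (hf q)]
    exact finsum_congr fun i => by rw [pd_add]; ring
  rintro ⟨z, b, l⟩ c ⟨h1, h2, h3⟩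
  simp only at h1 h2
  subst h1
  obtain ⟨M, hM⟩ := b.support.exists_nat_subset_range
  have hM' : ∀ j, M ≤ j → b j = 0 := by
    intro j hj
    by_contra h
    have := hM (Finsupp.mem_support_iff.2 h)
    simp at this; omega
  rw [fsum_range (M + 2)]
  · rw [Finset.sum_range_succ', Finset.sum_range_succ', ← h3]
    have hj : ∀ j ∈ Finset.range M, ((j + 1 + 1 : ℕ) : RR) * (uu (j+1+1) * pp (j+1+1)
        (AddMonoidAlgebra.single (z, b, 0) c)) =
        (((j : ℤ) + 2) * (b j : ℤ)) • AddMonoidAlgebra.single (z, b, 0) c := by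
      intro j _
      rw [pd2_single]
      simp only [uVar, AddMonoidAlgebra.single_mul_single, Prod.mk_add_mk, zero_add]
      by_cases hb : b j = 0
      · simp [hb]
      have e : Finsupp.single j 1 + (b - Finsupp.single j 1) = b := by
        ext k
        simp only [Finsupp.add_apply, Finsupp.tsub_apply, Finsupp.single_apply]
        split_ifs with hk
        · subst hk; omega
        · omega
      rw [e, one_mul, ← nsmul_eq_mul, AddMonoidAlgebra.smul_single, AddMonoidAlgebra.smul_single]
      congr 1
      rw [← natCast_zsmul, ← natCast_zsmul, smul_smul]
      push_cast; ring_nf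
    have h1' : ((0 + 1 : ℕ) : RR) * (uu (0+1) * pp (0+1) (AddMonoidAlgebra.single (z, b, 0) c))
        = z • AddMonoidAlgebra.single (z, b, 0) c := by
      rw [pd1_single]
      simp [uVar, AddMonoidAlgebra.single_mul_single]
    rw [Finset.sum_congr rfl hj, h1', ← Finset.sum_smul]
    simp only [wtM, Nat.cast_zero, zero_mul, add_zero]
    rw [← add_smul, add_comm z]
    congr 2
    rw [Finsupp.sum]
    symm
    refine Finset.sum_subset hM fun j _ hj => ?_
    rw [Finsupp.notMem_support_iff.1 hj]; simp
  · intro i hi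
    obtain ⟨j, rfl⟩ : ∃ j, i = j + 2 := ⟨i - 2, by omega⟩
    rw [pd2_single]
    simp [hM' j (by omega)]

lemma zsmul_eq_zero' {d : ℤ} (hd : d ≠ 0) {p : RR} (h : d • p = 0) : p = 0 := by
  have h2 : (d : ℝ) • p = 0 := (Int.cast_smul_eq_zsmul ℝ d p).trans h
  have hd' : (d : ℝ) ≠ 0 := by exact_mod_cast hd
  rw [← one_smul ℝ p, ← inv_mul_cancel₀ hd', mul_smul, h2, smul_zero]

lemma HH_all_pd {d : ℤ} (hd : d ≠ 0) {p : RR} (hp : HH d p) (h : ∀ i, pp i p = 0) : p = 0 := by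
  have := euler hp 0 (fun i _ => h i)
  simp only [Finset.range_zero, Finset.sum_empty] at this
  exact zsmul_eq_zero' hd this.symm

lemma HH_top {d : ℤ} (hd : d ≠ 0) {p : RR} (hp : HH d p) (h0 : p ≠ 0) :
    ∃ m, pp m p ≠ 0 ∧ ∀ i, m < i → pp i p = 0 := by
  by_contra hcon
  push Not at hcon
  apply h0
  apply HH_all_pd hd hp
  obtain ⟨N, hN⟩ := pd_fin p
  have : ∀ k i, N ≤ i + k → pp i p = 0 := by
    intro k
    induction k with
    | zero => intro i hi; exact hN i (by omega)
    | succ k ih =>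
      intro i hi
      by_contra h
      obtain ⟨j, hj, hj'⟩ := hcon i h
      exact hj' (ih j (by omega))
  exact fun i => this N i (by omega)

lemma HH_ker {d : ℤ} (hd : d ≠ 0) {p : RR} (hp : HH d p) (h : DD p = 0) : p = 0 := by
  by_contra h0
  obtain ⟨m, hm, hm'⟩ := HH_top hd hp h0
  have := pd_dx_succ m p
  rw [h, pd_zero, hm' (m+1) (by omega), dx_zero, zero_add] at this
  exact hm this.symm


lemma exact_aux (k : ℕ) : ∀ (dc db : ℤ) (c b : RR), HH dc c → HH db b →
    ∃ q, HH (dc + db + k - 1) q ∧ (-1)^k * (DD)^[k] c * b - c * (DD)^[k] b = DD q := by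
  induction k with
  | zero =>
    intro dc db c b _ _
    refine ⟨0, HH_zero _, ?_⟩
    rw [dx_zero]
    simp only [Function.iterate_zero, id]
    ring
  | succ k ih =>
    intro dc db c b hc hb
    obtain ⟨q, hq, e⟩ := ih (dc + 1) db (DD c) b (HH_dx hc) hb
    refine ⟨-q - c * (DD)^[k] b, HH_sub (HH_neg (HH_congr hq (by push_cast; ring)))
      (HH_congr (HH_mul hc (HH_di hb k)) (by push_cast; ring)), ?_⟩
    rw [dx_sub, dx_neg, dx_mul, ← e, di_succ' k c, di_succ k b]
    ring

lemma exact_sum {ι : Type*} (t : Finset ι) (d : ℤ) (f : ι → RR)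
    (h : ∀ k ∈ t, ∃ q, HH d q ∧ f k = DD q) : ∃ q, HH d q ∧ ∑ k ∈ t, f k = DD q := by
  induction t using Finset.induction_on with
  | empty => exact ⟨0, HH_zero _, by rw [dx_zero]; rfl⟩
  | insert a t ha ih =>
    obtain ⟨q, hq, e⟩ := ih fun k hk => h k (Finset.mem_insert_of_mem hk)
    obtain ⟨q', hq', e'⟩ := h a (Finset.mem_insert_self _ _)
    exact ⟨q' + q, HH_add hq' hq, by rw [Finset.sum_insert ha, e, e', dx_add]⟩

lemma exact_TT {e da db : ℤ} {x a b : RR} (hx : HH e x) (ha : HH da a) (hb : HH db b) :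
    ∃ q, HH (e + da + db - 1) q ∧ TT x a * b - a * XH b x = DD q := by
  obtain ⟨N, h⟩ := pd_fin x
  rw [TT_eq x a N h, XH_eq b x N h, Finset.sum_mul, Finset.mul_sum, ← sum_sub']
  refine exact_sum _ _ _ fun i _ => ?_
  obtain ⟨q, hq, e'⟩ := exact_aux i _ _ (pp i x * a) b (HH_mul (HH_pd hx i) ha) hb
  refine ⟨q, HH_congr hq (by ring), ?_⟩
  rw [← e']; ring

lemma tri (F : ℕ → ℕ → ℕ → RR) (n : ℕ) :
    ∑ k ∈ Finset.range (n+1), ∑ l ∈ Finset.range (n-k+1), F k l (n-k-l)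
    = ∑ k ∈ Finset.range (n+1), ∑ l ∈ Finset.range (k+1), F l (k-l) (n-k) := by
  rw [Finset.sum_sigma', Finset.sum_sigma']
  refine Finset.sum_bij' (fun x _ => ⟨x.1 + x.2, x.1⟩) (fun x _ => ⟨x.2, x.1 - x.2⟩) ?_ ?_ ?_ ?_ ?_
  · rintro ⟨k, l⟩ h
    simp only [Finset.mem_sigma, Finset.mem_range] at h ⊢; omega
  · rintro ⟨k, l⟩ h
    simp only [Finset.mem_sigma, Finset.mem_range] at h ⊢; omega
  · rintro ⟨k, l⟩ h
    simp only [Finset.mem_sigma, Finset.mem_range] at h ⊢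
    congr 1; omega
  · rintro ⟨k, l⟩ h
    simp only [Finset.mem_sigma, Finset.mem_range] at h ⊢
    congr 1; omega
  · rintro ⟨k, l⟩ h
    simp only [Finset.mem_sigma, Finset.mem_range] at h ⊢
    congr 1 <;> omega

lemma swp (F : ℕ → ℕ → ℕ → RR) (n : ℕ) :
    ∑ k ∈ Finset.range (n+1), ∑ l ∈ Finset.range (n-k+1), F k l (n-k-l)
    = ∑ k ∈ Finset.range (n+1), ∑ l ∈ Finset.range (n-k+1), F l k (n-k-l) := by
  rw [Finset.sum_sigma', Finset.sum_sigma']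
  refine Finset.sum_bij' (fun x _ => ⟨x.2, x.1⟩) (fun x _ => ⟨x.2, x.1⟩) ?_ ?_ ?_ ?_ ?_
  · rintro ⟨k, l⟩ h
    simp only [Finset.mem_sigma, Finset.mem_range] at h ⊢; omega
  · rintro ⟨k, l⟩ h
    simp only [Finset.mem_sigma, Finset.mem_range] at h ⊢; omega
  · rintro ⟨k, l⟩ h
    rfl
  · rintro ⟨k, l⟩ h
    rfl
  · rintro ⟨k, l⟩ h
    simp only
    congr 1; omega

/-- graded operators -/
def HO (e : ℤ) (P : Op S) : Prop := ∀ n j : ℕ, HH (n + e - j) (P n j)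

lemma HO_zero {P : Op S} {e : ℤ} (he : e ≤ 1) (h : HO e P) {n k j : ℕ} (hk : k ≤ n) (hj : n + 2 ≤ j) :
    P k j = 0 := HH_neg_zero (h k j) (by omega)

lemma HO_of_InD {P : Op S} (h : InD S P) : HO 1 P := by
  intro n j
  by_cases hj : j ≤ n + 1
  · exact (HH_iff _ _).2 ((h n j).2 hj)
  · rw [(h n j).1 (by omega)]; exact HH_zero _

lemma InD_of_HO {P : Op S} (h : HO 1 P) : InD S P := fun n j =>
  ⟨fun hj => HH_neg_zero (h n j) (by omega), fun _ => (HH_iff _ _).1 (h n j)⟩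

lemma InA_iff (a : Ser S) : InA S a ↔ ∀ n : ℕ, HH n (a n) :=
  ⟨fun h n => (HH_iff _ _).2 (h n), fun h n => (HH_iff _ _).1 (h n)⟩

lemma HO_opL {X : Ser S} (hX : InA S X) : HO 0 (opL S hS X) := fun n j =>
  HH_congr (HH_pd ((InA_iff X).1 hX n) j) (by ring)

lemma HO_opR {X : Ser S} (hX : InA S X) : HO 0 (opR S hS X) := by
  intro n j
  obtain ⟨N, h⟩ := pd_fin (X n)
  unfold opR
  rw [fsum_range N]
  · refine HH_sum _ _ fun k _ => ?_
    split_ifs with hjk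
    · rw [mul_assoc]
      exact HH_sgn (HH_nat (HH_congr (HH_di (HH_pd ((InA_iff X).1 hX n) k) (k-j))
        (by push_cast [hjk]; ring)) _) _
    · exact HH_zero _
  · intro k hk
    rw [h k hk, di_zero, mul_zero, ite_self]

lemma HH_cmpR {d e : ℤ} {p q : ℕ → RR} (hp : ∀ j : ℕ, HH (d - j) (p j)) (hq : ∀ j : ℕ, HH (e - j) (q j))
    (j : ℕ) : HH (d + e - j) (cmpR p q j) := by
  have h1 : ∀ i, (d.toNat + e.toNat + 1) ≤ i → p i = 0 := fun i hi => HH_neg_zero (hp i) (by omega)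
  have h2 : ∀ i, (d.toNat + e.toNat + 1) ≤ i → q i = 0 := fun i hi => HH_neg_zero (hq i) (by omega)
  rw [cmpR_eq p q _ h1 h2]
  refine HH_sum _ _ fun i _ => HH_sum _ _ fun l _ => HH_sum _ _ fun r hr => ?_
  have := Finset.mem_range.1 hr
  split_ifs with hj
  · rw [mul_assoc]
    exact HH_nat (HH_congr (HH_mul (hp i) (HH_di (hq l) r)) (by omega)) _
  · exact HH_zero _

lemma compOp_eq (P Q : Op S) (n j : ℕ) :
    compOp S hS P Q n j = ∑ k ∈ Finset.range (n+1), cmpR (P k) (Q (n-k)) j := rfl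

lemma appOp_eq (P : Op S) (a : Ser S) (n : ℕ) :
    appOp S hS P a n = ∑ k ∈ Finset.range (n+1), ap (P k) (a (n-k)) := rfl

lemma HO_comp {d e : ℤ} {P Q : Op S} (hP : HO d P) (hQ : HO e Q) : HO (d + e) (compOp S hS P Q) := by
  intro n j
  rw [compOp_eq]
  refine HH_sum _ _ fun k hk => ?_
  have := Finset.mem_range.1 hk
  exact HH_congr (HH_cmpR (hP k) (hQ (n-k)) j) (by omega)

def XOp (X : Ser S) (P : Op S) : Op S := fun n j => ∑ k ∈ Finset.range (n+1), XH (X k) (P (n-k) j)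

lemma HO_XOp {X : Ser S} (hX : InA S X) {P : Op S} {e : ℤ} (hP : HO e P) : HO e (XOp X P) := by
  intro n j
  refine HH_sum _ _ fun k hk => ?_
  have := Finset.mem_range.1 hk
  exact HH_congr (HH_XH ((InA_iff X).1 hX k) (hP (n-k) j)) (by omega)

lemma LieOp_eq (X : Ser S) (P : Op S) (n j : ℕ) : LieOp S hS X P n j =
    XOp X P n j - compOp S hS (opL S hS X) P n j - compOp S hS P (opR S hS X) n j := rfl

lemma HO_Lie {X : Ser S} (hX : InA S X) {P : Op S} (hP : HO 1 P) : HO 1 (LieOp S hS X P) := by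
  intro n j
  rw [LieOp_eq]
  exact HH_sub (HH_sub (HO_XOp hX hP n j) (HH_congr (HO_comp (HO_opL hX) hP n j) (by ring)))
    (HH_congr (HO_comp hP (HO_opR hX) n j) (by ring))

lemma XS_mul (X a b : Ser S) (n : ℕ) : XhatSer S hS X (mulSer S a b) n =
    mulSer S (XhatSer S hS X a) b n + mulSer S a (XhatSer S hS X b) n := by
  simp only [XhatSer, mulSer, XH_sum, XH_mul, Finset.sum_add_distrib, Finset.sum_mul, Finset.mul_sum]
  congr 1
  · exact tri (fun k l m => XH (X k) (a l) * b m) n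
  · exact swp (fun k l m => a l * XH (X k) (b m)) n

lemma XS_app (X a : Ser S) (P : Op S) (hP : HO 1 P) (n : ℕ) : XhatSer S hS X (appOp S hS P a) n =
    appOp S hS (XOp X P) a n + appOp S hS P (XhatSer S hS X a) n := by
  have hb : ∀ k, k ≤ n → ∀ i, n + 2 ≤ i → P k i = 0 := fun k hk i hi => HO_zero le_rfl hP hk hi
  have e1 : XhatSer S hS X (appOp S hS P a) n = ∑ k ∈ Finset.range (n+1), ∑ l ∈ Finset.range (n-k+1),
      (ap (fun j => XH (X k) (P l j)) (a (n-k-l)) + ap (P l) (XH (X k) (a (n-k-l)))) := by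
    unfold XhatSer
    refine Finset.sum_congr rfl fun k _ => ?_
    rw [appOp_eq, XH_sum]
    refine Finset.sum_congr rfl fun l hl => ?_
    have := Finset.mem_range.1 hl
    rw [XH_ap _ _ (n+2) (hb l (by omega))]
  rw [e1]
  simp only [Finset.sum_add_distrib]
  congr 1
  · rw [tri (fun k l m => ap (fun j => XH (X k) (P l j)) (a m)), appOp_eq]
    refine Finset.sum_congr rfl fun k hk => ?_
    have := Finset.mem_range.1 hk
    unfold XOp
    rw [ap_sum_left _ _ (n+2)]
    intro l hl i hi
    rw [hb _ (by omega) i hi, XH_zero]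
  · rw [swp (fun k l m => ap (P l) (XH (X k) (a m))), appOp_eq]
    refine Finset.sum_congr rfl fun k hk => ?_
    have := Finset.mem_range.1 hk
    unfold XhatSer
    rw [ap_sum_right _ (n+2) (hb k (by omega))]

lemma VS (X f : Ser S) (n : ℕ) : varDerSer S hS (XhatSer S hS X f) n =
    XhatSer S hS X (varDerSer S hS f) n + appOp S hS (opR S hS X) (varDerSer S hS f) n := by
  rw [appOp_eq]
  unfold varDerSer XhatSer
  rw [VD_sum, ← Finset.sum_add_distrib]
  refine Finset.sum_congr rfl fun k _ => ?_
  rw [VD_XH, ap_opR (X k) _ (opR S hS X k) (fun j => rfl)]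

lemma app_comp {d e : ℤ} {P Q : Op S} (hd : d ≤ 1) (he : e ≤ 1) (hP : HO d P) (hQ : HO e Q) (a : Ser S)
    (n : ℕ) : appOp S hS (compOp S hS P Q) a n = appOp S hS P (appOp S hS Q a) n := by
  have hb : ∀ k, k ≤ n → ∀ i, n + 2 ≤ i → P k i = 0 := fun k hk i hi => HO_zero hd hP hk hi
  have hc : ∀ k, k ≤ n → ∀ i, n + 2 ≤ i → Q k i = 0 := fun k hk i hi => HO_zero he hQ hk hi
  have e1 : appOp S hS P (appOp S hS Q a) n = ∑ k ∈ Finset.range (n+1), ∑ l ∈ Finset.range (n-k+1),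
      ap (P k) (ap (Q l) (a (n-k-l))) := by
    rw [appOp_eq]
    refine Finset.sum_congr rfl fun k hk => ?_
    have := Finset.mem_range.1 hk
    rw [appOp_eq, ap_sum_right _ (n+2) (hb k (by omega))]
  rw [e1, tri (fun k l m => ap (P k) (ap (Q l) (a m))), appOp_eq]
  refine Finset.sum_congr rfl fun k hk => ?_
  have := Finset.mem_range.1 hk
  rw [show compOp S hS P Q k = fun j => ∑ l ∈ Finset.range (k+1), cmpR (P l) (Q (k-l)) j from rfl]
  rw [ap_sum_left _ _ (2*(n+2))]
  · refine Finset.sum_congr rfl fun l hl => ?_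
    have := Finset.mem_range.1 hl
    exact ap_cmpR _ _ _ (n+2) (hb _ (by omega)) (hc _ (by omega))
  · intro l hl i hi
    have := Finset.mem_range.1 hl
    exact cmpR_zero _ _ (n+2) (hb _ (by omega)) (hc _ (by omega)) i hi

lemma exact_ser {X a b : Ser S} (hX : InA S X) (ha : InA S a) (hb : ∀ n : ℕ, HH (n+1) (b n)) (n : ℕ) :
    ∃ q, HH n q ∧ mulSer S (appOp S hS (opR S hS X) a) b n - mulSer S a (appOp S hS (opL S hS X) b) n = DD q := by
  have e1 : mulSer S (appOp S hS (opR S hS X) a) b n =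
      ∑ k ∈ Finset.range (n+1), ∑ l ∈ Finset.range (k+1), TT (X l) (a (k-l)) * b (n-k) := by
    unfold mulSer
    refine Finset.sum_congr rfl fun k _ => ?_
    rw [appOp_eq, Finset.sum_mul]
    exact Finset.sum_congr rfl fun l _ => by rw [ap_opR (X l) _ (opR S hS X l) (fun j => rfl)]
  have e2 : mulSer S a (appOp S hS (opL S hS X) b) n =
      ∑ k ∈ Finset.range (n+1), ∑ l ∈ Finset.range (k+1), a (k-l) * XH (b (n-k)) (X l) := by
    rw [← tri (fun k l m => a l * XH (b m) (X k)), swp (fun k l m => a l * XH (b m) (X k))]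
    unfold mulSer
    refine Finset.sum_congr rfl fun k _ => ?_
    rw [appOp_eq, Finset.mul_sum]
    exact Finset.sum_congr rfl fun l _ => by rw [← ap_opL (X l)]; rfl
  rw [e1, e2, ← sum_sub']
  refine exact_sum _ _ _ fun k hk => ?_
  rw [← sum_sub']
  refine exact_sum _ _ _ fun l hl => ?_
  have := Finset.mem_range.1 hk
  have := Finset.mem_range.1 hl
  obtain ⟨q, hq, e⟩ := exact_TT ((InA_iff X).1 hX l) ((InA_iff a).1 ha (k-l)) (hb (n-k))
  exact ⟨q, HH_congr hq (by omega), e⟩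

lemma mulSer_add_left (a b c : Ser S) (n : ℕ) : mulSer S (fun n => a n + b n) c n = mulSer S a c n + mulSer S b c n := by
  unfold mulSer
  rw [← Finset.sum_add_distrib]
  exact Finset.sum_congr rfl fun k _ => add_mul _ _ _

lemma mulSer_add_right (a b c : Ser S) (n : ℕ) : mulSer S a (fun n => b n + c n) n = mulSer S a b n + mulSer S a c n := by
  unfold mulSer
  rw [← Finset.sum_add_distrib]
  exact Finset.sum_congr rfl fun k _ => mul_add _ _ _

lemma mulSer_sub_right (a b c : Ser S) (n : ℕ) : mulSer S a (fun n => b n - c n) n = mulSer S a b n - mulSer S a c n := by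
  unfold mulSer
  rw [← sum_sub']
  exact Finset.sum_congr rfl fun k _ => by ring

lemma appOp_add_right {P : Op S} (hP : HO 1 P) (a b : Ser S) (n : ℕ) :
    appOp S hS P (fun n => a n + b n) n = appOp S hS P a n + appOp S hS P b n := by
  simp only [appOp_eq]
  rw [← Finset.sum_add_distrib]
  refine Finset.sum_congr rfl fun k hk => ?_
  have := Finset.mem_range.1 hk
  exact ap_add_right _ (n+2) (fun i hi => HO_zero le_rfl hP (show k ≤ n by omega) hi) _ _

lemma appOp_sub_left {P Q : Op S} (hP : HO 1 P) (hQ : HO 1 Q) (a : Ser S) (n : ℕ) :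
    appOp S hS (fun n j => P n j - Q n j) a n = appOp S hS P a n - appOp S hS Q a n := by
  simp only [appOp_eq]
  rw [← sum_sub']
  refine Finset.sum_congr rfl fun k hk => ?_
  have := Finset.mem_range.1 hk
  have h1 : ∀ i, n + 2 ≤ i → P k i = 0 := fun i hi => HO_zero le_rfl hP (show k ≤ n by omega) hi
  have h2 : ∀ i, n + 2 ≤ i → Q k i = 0 := fun i hi => HO_zero le_rfl hQ (show k ≤ n by omega) hi
  rw [ap_eq _ _ _ h1, ap_eq _ _ _ h2, ap_eq _ _ (n+2), ← sum_sub']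
  · exact Finset.sum_congr rfl fun i _ => by ring
  · intro i hi; rw [h1 i hi, h2 i hi]; ring

lemma HH_appOp {P : Op S} (hP : HO 1 P) {a : Ser S} (ha : InA S a) (n : ℕ) : HH (n+1) (appOp S hS P a n) := by
  rw [appOp_eq]
  refine HH_sum _ _ fun k hk => ?_
  have := Finset.mem_range.1 hk
  exact HH_congr (HH_ap (hP k) ((InA_iff a).1 ha (n-k))) (by omega)

lemma InA_VD {f : Ser S} (hf : InA S f) : InA S (varDerSer S hS f) :=
  (InA_iff _).2 fun n => HH_VD ((InA_iff f).1 hf n)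

lemma main_exact {X : Ser S} (hX : InA S X) {P : Op S} (hP : HO 1 P) {f g : Ser S} (hf : InA S f)
    (hg : InA S g) : ∃ q : Ser S, InA S q ∧ ∀ n, pbDen S hS (LieOp S hS X P) f g n
      - (XhatSer S hS X (pbDen S hS P f g) n - pbDen S hS P (XhatSer S hS X f) g n
        - pbDen S hS P f (XhatSer S hS X g) n) = DD (q n) := by
  have hq := fun n => exact_ser hX (InA_VD hf) (fun n => HH_appOp hP (InA_VD hg) n) n
  choose q hq1 hq2 using hq
  refine ⟨q, (InA_iff q).2 hq1, fun n => ?_⟩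
  rw [← hq2 n]
  have hL1 : HO 1 (compOp S hS (opL S hS X) P) := HO_comp (HO_opL hX) hP
  have hL2 : HO 1 (compOp S hS P (opR S hS X)) := HO_comp hP (HO_opR hX)
  have hXP : HO 1 (XOp X P) := HO_XOp hX hP
  have h12 : HO 1 (fun n j => XOp X P n j - compOp S hS (opL S hS X) P n j) :=
    fun n j => HH_sub (hXP n j) (hL1 n j)
  have hLie : LieOp S hS X P = fun n j => (fun n j => XOp X P n j - compOp S hS (opL S hS X) P n j) n j
    - compOp S hS P (opR S hS X) n j := rfl
  set a := varDerSer S hS f with ha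
  set b := varDerSer S hS g with hb
  have e1 : pbDen S hS (LieOp S hS X P) f g n = mulSer S a (appOp S hS (XOp X P) b) n
      - mulSer S a (appOp S hS (opL S hS X) (appOp S hS P b)) n
      - mulSer S a (appOp S hS P (appOp S hS (opR S hS X) b)) n := by
    have : appOp S hS (LieOp S hS X P) b = fun n =>
      (fun n => appOp S hS (XOp X P) b n - appOp S hS (opL S hS X) (appOp S hS P b) n) n
      - appOp S hS P (appOp S hS (opR S hS X) b) n := by
      funext m
      rw [hLie, appOp_sub_left h12 hL2, appOp_sub_left hXP hL1,
        app_comp (by norm_num) le_rfl (HO_opL hX) hP, app_comp le_rfl (by norm_num) hP (HO_opR hX)]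
    unfold pbDen
    rw [← ha, ← hb, this, mulSer_sub_right, mulSer_sub_right]
  have e2 : XhatSer S hS X (pbDen S hS P f g) n = mulSer S (XhatSer S hS X a) (appOp S hS P b) n
      + (mulSer S a (appOp S hS (XOp X P) b) n + mulSer S a (appOp S hS P (XhatSer S hS X b)) n) := by
    unfold pbDen
    rw [← ha, ← hb, XS_mul, show XhatSer S hS X (appOp S hS P b) = fun n => appOp S hS (XOp X P) b n +
      appOp S hS P (XhatSer S hS X b) n from funext fun m => XS_app X b P hP m, mulSer_add_right]
  have e3 : pbDen S hS P (XhatSer S hS X f) g n = mulSer S (XhatSer S hS X a) (appOp S hS P b) n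
      + mulSer S (appOp S hS (opR S hS X) a) (appOp S hS P b) n := by
    unfold pbDen
    rw [show varDerSer S hS (XhatSer S hS X f) = fun n => XhatSer S hS X a n + appOp S hS (opR S hS X) a n
      from funext fun m => VS X f m, mulSer_add_left]
  have e4 : pbDen S hS P f (XhatSer S hS X g) n = mulSer S a (appOp S hS P (XhatSer S hS X b)) n
      + mulSer S a (appOp S hS P (appOp S hS (opR S hS X) b)) n := by
    unfold pbDen
    rw [show varDerSer S hS (XhatSer S hS X g) = fun n => XhatSer S hS X b n + appOp S hS (opR S hS X) b n
      from funext fun m => VS X g m, show appOp S hS P (fun n => XhatSer S hS X b n +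
      appOp S hS (opR S hS X) b n) = fun n => appOp S hS P (XhatSer S hS X b) n +
      appOp S hS P (appOp S hS (opR S hS X) b) n from funext fun m => appOp_add_right hP _ _ m,
      mulSer_add_right]
  rw [e1, e2, e3, e4]
  ring

lemma main_mem {X : Ser S} (hX : InA S X) {P : Op S} (hP : HO 1 P) {f g : Ser S} (hf : InA S f)
    (hg : InA S g) : pbDen S hS (LieOp S hS X P) f g
      - (XhatSer S hS X (pbDen S hS P f g) - pbDen S hS P (XhatSer S hS X f) g
        - pbDen S hS P f (XhatSer S hS X g)) ∈ LamSub S hS (InA S) := by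
  obtain ⟨q, hq, e⟩ := main_exact hX hP hf hg
  exact Submodule.subset_span (Or.inl ⟨q, hq, funext e⟩)


lemma mk_sub' (a b : Ser S) : intdx S hS (InA S) a - intdx S hS (InA S) b = intdx S hS (InA S) (a - b) := rfl
lemma mk_eq' (a b : Ser S) : intdx S hS (InA S) a = intdx S hS (InA S) b ↔ a - b ∈ LamSub S hS (InA S) :=
  Submodule.Quotient.eq _

lemma intdx_iff (a b c d : Ser S) : intdx S hS (InA S) a = intdx S hS (InA S) b - intdx S hS (InA S) c
    - intdx S hS (InA S) d ↔ a - (b - c - d) ∈ LamSub S hS (InA S) := by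
  rw [mk_sub', mk_sub', mk_eq']

theorem existence (X : Ser S) (hX : InB S X) (P : Op S) (hP : InD S P) :
    (InD S (LieOp S hS X P) ∧
      (∀ f g : Ser S, InA S f → InA S g →
        intdx S hS (InA S) (pbDen S hS (LieOp S hS X P) f g)
          = intdx S hS (InA S) (XhatSer S hS X (pbDen S hS P f g))
            - intdx S hS (InA S) (pbDen S hS P (XhatSer S hS X f) g)
            - intdx S hS (InA S) (pbDen S hS P f (XhatSer S hS X g)))) :=
  ⟨InD_of_HO (HO_Lie hX.1 (HO_of_InD hP)), fun _ _ hf hg =>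
    (intdx_iff _ _ _ _).2 (main_mem hX.1 (HO_of_InD hP) hf hg)⟩

lemma LamSub_exact {a : Ser S} (ha : a ∈ LamSub S hS (InA S)) (n : ℕ) (hn : n ≠ 0) : ∃ b, a n = DD b := by
  unfold LamSub at ha
  induction ha using Submodule.span_induction with
  | mem x hx =>
    rcases hx with ⟨b, _, rfl⟩ | ⟨c, rfl⟩
    · exact ⟨b n, rfl⟩
    · exact ⟨0, by rw [dx_zero]; exact if_neg hn⟩
  | zero => exact ⟨0, by rw [dx_zero]; rfl⟩
  | add x y _ _ h1 h2 =>
    obtain ⟨b, hb⟩ := h1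
    obtain ⟨c, hc⟩ := h2
    exact ⟨b + c, by rw [dx_add, ← hb, ← hc]; rfl⟩
  | smul r x _ h1 =>
    obtain ⟨b, hb⟩ := h1
    exact ⟨r • b, by rw [dx_smul, ← hb]; rfl⟩

lemma pd_sgn (k i : ℕ) (p : RR) : pp k ((-1)^i * p) = (-1)^i * pp k p := by
  rcases neg1_cases i with h | h
  · rw [h]; rw [one_mul, one_mul]
  · rw [h]
    have e : ∀ x : RR, -1 * x = -x := fun x => by ring
    rw [e, e, pd_neg]

lemma nat_mul_zero {n : ℕ} (hn : n ≠ 0) {x : RR} (h : (n : RR) * x = 0) : x = 0 := by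
  apply zsmul_eq_zero' (d := (n : ℤ)) (by exact_mod_cast hn)
  rw [natCast_zsmul, nsmul_eq_mul]; exact h

def VV (a : ℕ) (p : RR) : Prop := ∀ i, a < i → pp i p = 0

lemma VV_pd {a : ℕ} {p : RR} (h : VV a p) (k : ℕ) : VV a (pp k p) := fun i hi => by
  rw [pd_comm, h i hi, pd_zero]

lemma VV_mono {a b : ℕ} {p : RR} (h : VV a p) (hab : a ≤ b) : VV b p := fun i hi => h i (by omega)

lemma VV_mul {a : ℕ} {p q : RR} (h : VV a p) (h' : VV a q) : VV a (p * q) := fun i hi => by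
  rw [pd_mul, h i hi, h' i hi]; ring

lemma VV_uVar (k : ℕ) : VV k (uu k) := fun i hi => by
  rw [pd_uVar, if_neg (by omega)]

lemma VV_di {a : ℕ} {p : RR} (h : VV a p) (j : ℕ) : VV (a + j) ((DD)^[j] p) := by
  induction j with
  | zero => exact h
  | succ j ih =>
    intro i hi
    obtain ⟨i, rfl⟩ : ∃ k, i = k + 1 := ⟨i - 1, by omega⟩
    rw [di_succ, pd_dx_succ, ih _ (by omega), ih _ (by omega), dx_zero, add_zero]

lemma di_top {a : ℕ} {p : RR} (h : VV a p) (j : ℕ) : pp (a + j) ((DD)^[j] p) = pp a p := by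
  induction j with
  | zero => rfl
  | succ j ih =>
    rw [di_succ, ← add_assoc, pd_dx_succ, ih, VV_di h j _ (by omega), dx_zero, zero_add]

lemma di_top2 {a : ℕ} {p : RR} (h : VV (a+1) p) (j : ℕ) :
    pp (a + j) ((DD)^[j] p) = pp a p + j * DD (pp (a+1) p) := by
  induction j with
  | zero => simp
  | succ j ih =>
    have e := di_top h j
    rw [show a + 1 + j = a + j + 1 by omega] at e
    rw [di_succ, ← add_assoc, pd_dx_succ, ih, e]
    push_cast; ring

lemma TT_top (w : RR) (m c : ℕ) (hw : VV m w) (hc : m < c) :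
    pp (c + m) (TT w (uu c)) = (-1)^m * pp m w := by
  have hV : ∀ i, VV c (pp i w * uu c) := fun i => VV_mul (VV_mono (VV_pd hw i) (by omega)) (VV_uVar c)
  rw [TT_eq w _ (m+1) (fun i hi => hw i (by omega)), pd_sum, Finset.sum_range_succ]
  rw [Finset.sum_eq_zero, zero_add, pd_sgn, di_top (hV m), pd_mul, VV_pd hw m c hc, pd_uVar, if_pos rfl]
  · ring
  · intro i hi
    have := Finset.mem_range.1 hi
    rw [pd_sgn, VV_di (hV i) i _ (by omega), mul_zero]

lemma TT_top2 (w : RR) (m c : ℕ) (hw : VV (m+1) w) (hc : m + 1 < c) :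
    pp (c + 1 + m) (TT w (uu (c+1))) = (-1)^(m+1) * ((m+1 : ℕ) * DD (pp (m+1) w)) + (-1)^m * pp m w := by
  have hV : ∀ i, VV (c+1) (pp i w * uu (c+1)) := fun i =>
    VV_mul (VV_mono (VV_pd hw i) (by omega)) (VV_uVar _)
  have htop : ∀ i, pp (c+1) (pp i w * uu (c+1)) = pp i w := by
    intro i
    rw [pd_mul, VV_pd hw i _ (by omega), pd_uVar, if_pos rfl]; ring
  have hlow : ∀ i, pp c (pp i w * uu (c+1)) = 0 := by
    intro i
    rw [pd_mul, VV_pd hw i _ (by omega), pd_uVar, if_neg (by omega)]; ring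
  rw [TT_eq w _ (m+2) (fun i hi => hw i (by omega)), pd_sum, Finset.sum_range_succ, Finset.sum_range_succ]
  rw [Finset.sum_eq_zero, zero_add, pd_sgn, pd_sgn, di_top (hV m), htop,
    show c + 1 + m = c + (m + 1) by omega, di_top2 (hV (m+1)), htop, hlow]
  · ring
  · intro i hi
    have := Finset.mem_range.1 hi
    rw [pd_sgn, VV_di (hV i) i _ (by omega), mul_zero]

lemma sgn_even {m : ℕ} (h : Even m) : (-1 : RR)^m = 1 := by
  obtain ⟨t, rfl⟩ := h
  rw [pow_add]
  rcases neg1_cases t with h | h <;> rw [h] <;> ring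

lemma sgn_odd {m : ℕ} (h : Odd m) : (-1 : RR)^m = -1 := by
  obtain ⟨t, rfl⟩ := h
  rw [pow_succ, sgn_even (even_two_mul t)]
  ring

lemma w_zero {d : ℤ} {w : RR} (hd : Even d) (hd0 : d ≠ 0) (hw : HH d w)
    (h : ∀ A : ℕ, 1 ≤ A → (DD)^[2*A] w + TT w (uu (2*A)) = 0) : w = 0 := by
  by_contra hne
  obtain ⟨m, hm, hV⟩ := HH_top hd0 hw hne
  have hV : VV m w := hV
  have h1 : ∀ A : ℕ, m < A → pp m w + (-1)^m * pp m w = 0 := by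
    intro A hA
    have e := congrArg (pp (2*A+m)) (h A (by omega))
    rw [pd_add, pd_zero, TT_top w m (2*A) hV (by omega), add_comm (2*A) m, di_top hV] at e
    exact e
  rcases Nat.even_or_odd m with hev | hod
  · have := h1 (m+1) (by omega)
    rw [sgn_even hev] at this
    apply hm
    apply nat_mul_zero (n := 2) (by norm_num)
    push_cast
    linear_combination this
  · obtain ⟨m, rfl⟩ : ∃ k, m = k + 1 := ⟨m - 1, by have := hod.pos; omega⟩
    have hs : (-1 : RR)^(m+1) = -1 := sgn_odd hod
    have hs' : (-1 : RR)^m = 1 := by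
      apply sgn_even
      obtain ⟨t, ht⟩ := hod
      exact ⟨t, by omega⟩
    have h2 : ∀ A : ℕ, m + 2 < A → 2 * pp m w + ((2*A : ℕ) - (m+1 : ℕ)) * DD (pp (m+1) w) = 0 := by
      intro A hA
      have e := congrArg (pp (2*A+m)) (h A (by omega))
      rw [pd_add, pd_zero, add_comm (2*A) m, di_top2 hV (2*A)] at e
      have e2 := TT_top2 w m (2*A-1) hV (by omega)
      rw [show 2*A-1+1 = 2*A by omega, hs, hs', add_comm (2*A) m] at e2
      rw [e2] at e
      linear_combination e
    have h3 := h2 (m+3) (by omega)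
    have h4 := h2 (m+4) (by omega)
    have h5 : DD (pp (m+1) w) = 0 := by
      apply nat_mul_zero (n := 2) (by norm_num)
      push_cast at h3 h4 ⊢
      linear_combination h4 - h3
    refine hm (HH_ker ?_ (HH_pd hw (m+1)) h5)
    obtain ⟨r, hr⟩ := hd
    obtain ⟨t, ht⟩ := hod
    omega

lemma dx_uVar (k : ℕ) : DD (uu k) = uu (k+1) := by
  rw [dx_eq (uu k) (k+1) (fun i hi => VV_uVar k i (by omega)), Finset.sum_range_succ, Finset.sum_eq_zero,
    zero_add, pd_uVar, if_pos rfl, mul_one]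
  intro i hi
  have := Finset.mem_range.1 hi
  rw [pd_uVar, if_neg (by omega), mul_zero]

lemma di_uVar (k j : ℕ) : (DD)^[j] (uu k) = uu (k+j) := by
  induction j with
  | zero => rfl
  | succ j ih => rw [di_succ, ih, dx_uVar]; rfl

lemma TT_uVar (k : ℕ) (b : RR) : TT (uu k) b = (-1)^k * (DD)^[k] b := by
  rw [TT_eq (uu k) b (k+1) (fun i hi => VV_uVar k i (by omega)), Finset.sum_range_succ, Finset.sum_eq_zero,
    zero_add, pd_uVar, if_pos rfl, one_mul]
  intro i hi
  have := Finset.mem_range.1 hi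
  rw [pd_uVar, if_neg (by omega), zero_mul, di_zero, mul_zero]

lemma VD_sq (A : ℕ) : VD (uu A * uu A) = (-1)^A * (uu (2*A) + uu (2*A)) := by
  rw [VD_mul, TT_uVar, di_uVar, two_mul]; ring

lemma VD_neg' (p : RR) : VD (-p) = -VD p := map_neg VDh p

lemma VD_sgn_cancel {A : ℕ} {x w : RR} (h : VD ((-1)^A * (x + x) * w) = 0) : VD (x * w) = 0 := by
  apply nat_mul_zero (n := 2) (by norm_num)
  have e1 : (x + x) * w = x * w + x * w := by ring
  rcases neg1_cases A with hA | hA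
  · rw [hA, one_mul, e1, VD_add] at h
    push_cast; linear_combination h
  · rw [hA, show -1 * (x + x) * w = -(x * w + x * w) by ring, VD_neg', VD_add] at h
    push_cast; linear_combination -h

lemma VD_top {B : ℕ} {g : RR} (hg : VV B g) :
    VV (B + B) (VD g) ∧ pp (B + B) (VD g) = (-1)^B * pp B (pp B g) := by
  rw [VD_eq g (B+1) (fun i hi => hg i (by omega))]
  constructor
  · intro i hi
    rw [pd_sum]
    refine Finset.sum_eq_zero fun k hk => ?_
    have := Finset.mem_range.1 hk
    rw [pd_sgn, VV_di (VV_pd hg k) k _ (by omega), mul_zero]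
  · rw [pd_sum, Finset.sum_range_succ, Finset.sum_eq_zero, zero_add, pd_sgn, di_top (VV_pd hg B)]
    intro k hk
    have := Finset.mem_range.1 hk
    rw [pd_sgn, VV_di (VV_pd hg k) k _ (by omega), mul_zero]

def conc (d : ℕ) (g : RR) : Ser S := fun n => if n = d then g else 0

lemma InA_conc {d : ℕ} {g : RR} (hg : HH d g) : InA S (conc d g) := by
  rw [InA_iff]
  intro n
  unfold conc
  split_ifs with h
  · rw [h]; exact hg
  · exact HH_zero _

lemma VD_conc (d : ℕ) (g : RR) : varDerSer S hS (conc d g) = conc d (VD g) := by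
  funext n
  unfold varDerSer conc
  split_ifs
  · rfl
  · exact VD_zero

lemma app_conc (K : Op S) (d n : ℕ) (g : RR) : appOp S hS K (conc d g) (n + d) = ap (K n) g := by
  rw [appOp_eq, Finset.sum_eq_single_of_mem n (Finset.mem_range.2 (by omega))]
  · rw [show n + d - n = d by omega]; unfold conc; rw [if_pos rfl]
  · intro k hk hkn
    have := Finset.mem_range.1 hk
    unfold conc
    rw [if_neg (by omega), ap_zero_right]

lemma mul_conc (d n : ℕ) (g : RR) (b : Ser S) : mulSer S (conc d g) b (d + n) = g * b n := by
  unfold mulSer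
  rw [Finset.sum_eq_single_of_mem d (Finset.mem_range.2 (by omega))]
  · rw [show d + n - d = n by omega]; unfold conc; rw [if_pos rfl]
  · intro k hk hkn
    unfold conc
    rw [if_neg hkn, zero_mul]

lemma w_of_K {K : Op S} (hK : HO 1 K)
    (hpb : ∀ f g : Ser S, InA S f → InA S g → pbDen S hS K f g ∈ LamSub S hS (InA S))
    (n dg : ℕ) (g : RR) (hg : HH dg g) (he : Even (n + 1 + dg)) : ap (K n) (VD g) = 0 := by
  have hw : HH ((n : ℤ) + 1 + dg) (ap (K n) (VD g)) := HH_ap (hK n) (HH_VD hg)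
  refine w_zero (by exact_mod_cast he) (by omega) hw fun A hA => ?_
  have hf : HH (2*A : ℕ) (uu A * uu A) := HH_congr (HH_mul (HH_uVar A) (HH_uVar A)) (by push_cast; ring)
  obtain ⟨b, hb⟩ := LamSub_exact (hpb _ _ (InA_conc hf) (InA_conc hg)) (2*A + (n + dg)) (by omega)
  unfold pbDen at hb
  rw [VD_conc, VD_conc, mul_conc, app_conc, VD_sq] at hb
  have h0 := VD_dx b
  rw [← hb] at h0
  have h1 := VD_sgn_cancel h0
  rw [VD_mul, TT_uVar, sgn_even (even_two_mul A), one_mul] at h1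
  exact h1

lemma unit_q (n : ℕ) : ∃ (dq : ℕ) (q r : RR), HH dq q ∧ VV 1 q ∧ q * r = 1 ∧ Even (n + 1 + dq) := by
  rcases Nat.even_or_odd (n+1) with h | h
  · refine ⟨0, 1, 1, ?_, fun i _ => pd_one i, mul_one _, h⟩
    exact HH_single 1 ⟨rfl, le_rfl, by simp [wtM]⟩
  · refine ⟨1, uu 1, AddMonoidAlgebra.single (-1, 0, 0) 1, HH_uVar 1, VV_uVar 1, ?_, h.add_one⟩
    simp [uVar, AddMonoidAlgebra.single_mul_single]
    rfl

lemma K_zero {K : Op S} (hK : HO 1 K)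
    (hpb : ∀ f g : Ser S, InA S f → InA S g → pbDen S hS K f g ∈ LamSub S hS (InA S)) (n : ℕ) :
    ∀ k J : ℕ, n + 2 ≤ J + k → K n J = 0 := by
  intro k
  induction k with
  | zero => intro J hJ; exact HO_zero le_rfl hK le_rfl hJ
  | succ k ih =>
    intro J hJ
    have hz : ∀ j, J + 1 ≤ j → K n j = 0 := fun j hj => ih j (by omega)
    obtain ⟨dq, q, r, hq, hqV, hqr, he⟩ := unit_q n
    set B := n + 2 with hB
    set g := q * (uu B * uu B) with hg
    have hgH : HH (dq + 2*B : ℕ) g :=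
      HH_congr (HH_mul hq (HH_mul (HH_uVar B) (HH_uVar B))) (by push_cast; ring)
    have hgV : VV B g := VV_mul (VV_mono hqV (by omega)) (VV_mul (VV_uVar B) (VV_uVar B))
    have hw := w_of_K hK hpb n (dq + 2*B) g hgH (by rw [← add_assoc]; exact he.add (even_two_mul B))
    obtain ⟨t1, t2⟩ := VD_top hgV
    have hqB : pp B q = 0 := hqV B (by omega)
    have hgg : pp B (pp B g) = 2 * q := by
      have h1 : pp B g = q * uu B + q * uu B := by
        rw [hg, pd_mul, hqB, pd_mul, pd_uVar, if_pos rfl]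
        ring
      rw [h1, pd_add, pd_mul, hqB, pd_uVar, if_pos rfl]
      ring
    have hKV : ∀ j, ∀ i, n + 1 < i → pp i (K n j) = 0 := fun j i hi => HH_pd_zero (hK n j) i (by omega)
    rw [ap_eq _ _ (J+1) hz] at hw
    have e := congrArg (pp (B + B + J)) hw
    rw [pd_zero, pd_sum, Finset.sum_range_succ, Finset.sum_eq_zero, zero_add, pd_mul, di_top t1, t2, hgg,
      hKV J _ (by omega), zero_mul, zero_add] at e
    · apply nat_mul_zero (n := 2) (by norm_num)
      push_cast
      rcases neg1_cases B with h | h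
      · rw [h] at e; linear_combination r * e - 2 * K n J * hqr
      · rw [h] at e; linear_combination -r * e - 2 * K n J * hqr
    · intro j hj
      have := Finset.mem_range.1 hj
      rw [pd_mul, VV_di t1 j _ (by omega), hKV j _ (by omega)]
      ring

lemma mulSer_sub_right' (a b c : Ser S) : mulSer S a (fun n => b n - c n) = mulSer S a b - mulSer S a c :=
  funext fun n => mulSer_sub_right a b c n

lemma pb_sub {P Q : Op S} (hP : HO 1 P) (hQ : HO 1 Q) (f g : Ser S) :
    pbDen S hS (fun n j => P n j - Q n j) f g = pbDen S hS P f g - pbDen S hS Q f g := by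
  unfold pbDen
  rw [← mulSer_sub_right']
  congr 1
  funext n
  exact appOp_sub_left hP hQ _ n

lemma uniq_aux {P Q : Op S} (hP : HO 1 P) (hQ : HO 1 Q)
    (h : ∀ f g : Ser S, InA S f → InA S g →
      intdx S hS (InA S) (pbDen S hS P f g) = intdx S hS (InA S) (pbDen S hS Q f g)) : P = Q := by
  have hK : HO 1 (fun n j => P n j - Q n j) := fun n j => HH_sub (hP n j) (hQ n j)
  funext n j
  have := K_zero hK (fun f g hf hg => by
    rw [pb_sub hP hQ]; exact (mk_eq' _ _).1 (h f g hf hg)) n (n+2) j (by omega)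
  exact sub_eq_zero.1 this

/-- For any evolutionary PDE `X ∈ ℬ` and differential operator `P ∈ 𝒟` there is a unique
`Q ∈ 𝒟` with `{F,G}_Q = X.{F,G}_P - {X.F,G}_P - {F,X.G}_P` for all local functionals
`F, G ∈ Λ`, and this `Q = Lie_X P` is given by the explicit formula
`Q = ∑_s X̂(P_s)·∂ₓ^s - ∑ₖ ((∂X/∂uₖ)·∂ₓ^k·P + P·(-∂ₓ)^k·(∂X/∂uₖ))`. -/
theorem lie_derivative_exists_unique
    (X : Ser S) (hX : InB S X) (P : Op S) (hP : InD S P) :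
    (InD S (LieOp S hS X P) ∧
      (∀ f g : Ser S, InA S f → InA S g →
        intdx S hS (InA S) (pbDen S hS (LieOp S hS X P) f g)
          = intdx S hS (InA S) (XhatSer S hS X (pbDen S hS P f g))
            - intdx S hS (InA S) (pbDen S hS P (XhatSer S hS X f) g)
            - intdx S hS (InA S) (pbDen S hS P f (XhatSer S hS X g)))) ∧
    (∀ Q : Op S, InD S Q →
      (∀ f g : Ser S, InA S f → InA S g →
        intdx S hS (InA S) (pbDen S hS Q f g)
          = intdx S hS (InA S) (XhatSer S hS X (pbDen S hS P f g))
            - intdx S hS (InA S) (pbDen S hS P (XhatSer S hS X f) g)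
            - intdx S hS (InA S) (pbDen S hS P f (XhatSer S hS X g))) →
      Q = LieOp S hS X P) := by
  refine ⟨existence X hX P hP, fun Q hQ h => ?_⟩
  have hE := existence X hX P hP
  exact uniq_aux (HO_of_InD hQ) (HO_of_InD hE.1) fun f g hf hg =>
    (h f g hf hg).trans (hE.2 f g hf hg).symm

end
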